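/- arXiv:2604.02086 — 2 statements merged into one kernel-verified Lean document; each statement's English description precedes it below -/
import Mathlib

section
/- Let Ḡ be a 2-connected graph on 2n vertices with minimum degree at least ⌈n/2⌉ + 250, such that for all vertices u, v one has |N(u) ∪ N(v) \ {u,v}| ≥ n − 1. Then the circumference of Ḡ is at least 2n − 4. -/
open SimpleGraph

/-- `G` contains `H` as a (not necessarily induced) subgraph. -/
def Contains {V W : Type*} (G : SimpleGraph V) (H : SimpleGraph W) : Prop :=
  ∃ f : H →g G, Function.Injective f

/-- `G` has a cycle with `m` vertices (equivalently, of length `m`). -/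
def HasCycleLength {V : Type*} (G : SimpleGraph V) (m : ℕ) : Prop :=
  ∃ (v : V) (c : G.Walk v v), c.IsCycle ∧ c.length = m

/-- The Ramsey property for `K_{a,b}` versus the cycle `C_m`: every graph `Γ` on `N` vertices
contains `K_{a,b}`, or its complement contains a cycle of length `m`. -/
def RamseyProp (a b m N : ℕ) : Prop :=
  ∀ Γ : SimpleGraph (Fin N),
    Contains Γ (completeBipartiteGraph (Fin a) (Fin b)) ∨ HasCycleLength Γᶜ m

/-- `G` is `k`-connected. -/
def IsKConnected {V : Type*} [Fintype V] (k : ℕ) (G : SimpleGraph V) : Prop :=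
  k < Fintype.card V ∧
    ∀ S : Finset V, S.card < k → (G.induce ((↑S : Set V)ᶜ)).Connected

/-- The circumference of `G`: the length of a longest cycle. -/
noncomputable def circumference {V : Type*} (G : SimpleGraph V) : ℕ :=
  sSup {m | HasCycleLength G m}

/-- The list `l` enumerates the vertices of a cycle of `G` in cyclic order. -/
def IsVertexCycle {V : Type*} (G : SimpleGraph V) (l : List V) : Prop :=
  l.Nodup ∧ l.IsChain G.Adj ∧ 3 ≤ l.length ∧ ∀ x ∈ l.getLast?, ∀ y ∈ l.head?, G.Adj x y

theorem IsVertexCycle.hasCycleLength {V : Type*} {G : SimpleGraph V} {l : List V}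
    (hl : IsVertexCycle G l) : HasCycleLength G l.length := by
  obtain ⟨hnd, hch, hlen, hadj⟩ := hl
  have hne : l ≠ [] := by rintro rfl; simp at hlen
  have h : G.Adj (l.getLast hne) (l.head hne) :=
    hadj _ (List.getLast_mem_getLast? hne) _ (List.head_mem_head? hne)
  have hp : (Walk.ofSupport l hne hch).IsPath := by
    rw [Walk.isPath_def, Walk.support_ofSupport]; exact hnd
  refine ⟨_, Walk.cons h (Walk.ofSupport l hne hch), ?_, ?_⟩
  · rw [Walk.cons_isCycle_iff]
    refine ⟨hp, fun hmem => ?_⟩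
    rw [Sym2.eq_swap] at hmem
    have := hp.length_eq_one_of_mem_edges hmem
    rw [Walk.length_ofSupport] at this
    omega
  · rw [Walk.length_cons, Walk.length_ofSupport]
    omega

theorem le_circumference {V : Type*} [Fintype V] {G : SimpleGraph V} {m : ℕ}
    (h : HasCycleLength G m) : m ≤ circumference G := by
  classical
  refine le_csSup ⟨G.edgeFinset.card, ?_⟩ h
  rintro _ ⟨v, c, hc, rfl⟩
  exact hc.isTrail.length_le_card_edgeFinset

/-- If any two distinct vertices have at least `k` neighbours between them other than the two
vertices themselves, then `G` has a cycle with at least `k + 2` vertices. -/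
theorem exists_isVertexCycle_of_union {V : Type*} [Fintype V] [DecidableEq V] [Nonempty V]
    (G : SimpleGraph V) [DecidableRel G.Adj] (k : ℕ) (hδ : ∀ v, 2 ≤ G.degree v)
    (hnb : ∀ u v : V, u ≠ v →
      k ≤ ((G.neighborFinset u ∪ G.neighborFinset v) \ {u, v}).card) :
    ∃ l, IsVertexCycle G l ∧ k + 2 ≤ l.length := by
  classical
  -- take a longest path, and among the longest paths one whose first vertex has a neighbour
  -- as far along the path as possible; reversing an initial segment gives a second end vertex
  let Path : List V → Prop := fun l => l.Nodup ∧ l.IsChain G.Adj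
  have hbd : ∀ l, Path l → l.length ≤ Fintype.card V := fun l hl => hl.1.length_le_card
  obtain ⟨L, ⟨l₀, hl₀, hL₀⟩, hL⟩ : ∃ L, (∃ l, Path l ∧ l.length = L) ∧
      ∀ l, Path l → l.length ≤ L := by
    have hne : ∃ L, ∃ l, Path l ∧ l.length = L := ⟨0, [], by simp [Path], rfl⟩
    have hb : ∀ L, (∃ l, Path l ∧ l.length = L) → L ≤ Fintype.card V := by
      rintro _ ⟨l, hl, rfl⟩; exact hbd l hl
    refine ⟨Nat.findGreatest (fun L => ∃ l, Path l ∧ l.length = L) (Fintype.card V), ?_, ?_⟩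
    · obtain ⟨L, hL⟩ := hne
      exact Nat.findGreatest_spec (P := fun L => ∃ l, Path l ∧ l.length = L) (hb L hL) hL
    · intro l hl
      exact Nat.le_findGreatest (P := fun L => ∃ l, Path l ∧ l.length = L) (hbd l hl) ⟨l, hl, rfl⟩
  have hnbr : ∀ (l : List V) (x : V), Path l → l.length = L → x ∈ l.head? →
      ∀ y, G.Adj x y → y ∈ l := by
    intro l x hl hlL hx y hxy
    by_contra hy
    have : Path (y :: l) := by
      refine ⟨List.nodup_cons.2 ⟨hy, hl.1⟩, List.isChain_cons.2 ⟨fun z hz => ?_, hl.2⟩⟩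
      rw [Option.mem_unique hz hx]; exact hxy.symm
    have := hL _ this
    simp at this; omega
  let Far : List V → ℕ → Prop := fun l i => ∃ x ∈ l.head?, ∃ y ∈ l[i]?, G.Adj x y
  have hLpos : 0 < L := by
    obtain ⟨v⟩ := ‹Nonempty V›
    have := hL [v] (by simp [Path])
    exact this
  have hFar : ∀ l, Path l → l.length = L → ∃ i, 2 ≤ i ∧ Far l i := by
    intro l hl hlL
    obtain ⟨x, l', rfl⟩ := List.exists_cons_of_length_pos (hlL ▸ hLpos)
    have h2 := hδ x
    rw [← card_neighborFinset_eq_degree] at h2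
    obtain ⟨y, hy, z, hz, hyz⟩ := Finset.one_lt_card.1 (show 1 < _ from h2)
    rw [mem_neighborFinset] at hy hz
    obtain ⟨i, hi, rfl⟩ := List.getElem_of_mem (hnbr _ x hl hlL (by simp) y hy)
    obtain ⟨j, hj, rfl⟩ := List.getElem_of_mem (hnbr _ x hl hlL (by simp) z hz)
    have hi0 : i ≠ 0 := by rintro rfl; simp at hy
    have hj0 : j ≠ 0 := by rintro rfl; simp at hz
    have hij : i ≠ j := by rintro rfl; exact hyz rfl
    rcases le_or_gt 2 i with h | h
    · exact ⟨i, h, x, by simp, _, List.getElem?_eq_getElem hi, hy⟩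
    · exact ⟨j, by omega, x, by simp, _, List.getElem?_eq_getElem hj, hz⟩
  have hFarlt : ∀ l i, Far l i → i < l.length := by
    rintro l i ⟨x, -, y, hy, -⟩
    exact (List.getElem?_eq_some_iff.1 hy).1
  obtain ⟨i, ⟨l, hl, hlL, hli⟩, hmax⟩ : ∃ i, (∃ l, Path l ∧ l.length = L ∧ Far l i) ∧
      ∀ l j, Path l → l.length = L → Far l j → j ≤ i := by
    obtain ⟨i₀, -, hi₀⟩ := hFar l₀ hl₀ hL₀
    refine ⟨Nat.findGreatest (fun i => ∃ l, Path l ∧ l.length = L ∧ Far l i) L, ?_, ?_⟩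
    · exact Nat.findGreatest_spec (P := fun i => ∃ l, Path l ∧ l.length = L ∧ Far l i)
        (by have := hFarlt _ _ hi₀; omega) ⟨l₀, hl₀, hL₀, hi₀⟩
    · intro l j hl hlL hj
      exact Nat.le_findGreatest (P := fun i => ∃ l, Path l ∧ l.length = L ∧ Far l i)
        (by have := hFarlt _ _ hj; omega) ⟨l, hl, hlL, hj⟩
  have hmem : ∀ l' x, Path l' → l'.length = L → x ∈ l'.head? → ∀ y, G.Adj x y →
      y ∈ l'.take (i + 1) := by
    intro l' x hl' hlL' hx y hxy
    obtain ⟨j, hj, rfl⟩ := List.getElem_of_mem (hnbr _ x hl' hlL' hx y hxy)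
    have := hmax l' j hl' hlL' ⟨x, hx, _, List.getElem?_eq_getElem hj, hxy⟩
    exact List.mem_take_iff_getElem.2 ⟨j, by omega, rfl⟩
  obtain ⟨s, hs2, hs⟩ := hFar l hl hlL
  have hsi := hmax l s hl hlL hs
  have hilt := hFarlt _ _ hli
  obtain ⟨x, hx, y, hy, hxy⟩ := hs
  obtain ⟨x', hx', z, hz, hxz⟩ := hli
  obtain rfl := Option.mem_unique hx hx'
  let l' := (l.take s).reverse ++ l.drop s
  have hperm : ∀ t, s ≤ t → (l'.take t).Perm (l.take t) := by
    intro t ht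
    have h1 : l'.take t = (l.take s).reverse ++ (l.drop s).take (t - s) := by
      simp only [l']
      rw [List.take_append, List.take_of_length_le (by simp; omega)]
      congr 2
      simp; omega
    have h2 : l.take t = l.take s ++ (l.drop s).take (t - s) := by
      rw [← List.take_add]; congr 1; omega
    rw [h1, h2]
    exact (List.reverse_perm _).append_right _
  have hl'p : l'.Perm l := by
    simpa [l'] using ((List.reverse_perm (l.take s)).append_right (l.drop s))
  have hsl : s < l.length := (List.getElem?_eq_some_iff.1 hy).1
  have hl0 : l[0]? = some x := by rw [← List.head?_eq_getElem?]; exact hx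
  have hl' : Path l' := by
    refine ⟨hl'p.nodup_iff.2 hl.1, ?_⟩
    simp only [l']
    rw [List.isChain_append, List.isChain_reverse]
    refine ⟨?_, hl.2.drop s, ?_⟩
    · refine (hl.2.take s).imp fun a b h => h.symm
    · intro a ha b hb
      rw [List.getLast?_reverse, List.head?_take, if_neg (by omega)] at ha
      rw [List.head?_drop] at hb
      rw [Option.mem_unique ha hx, Option.mem_unique hb hy]
      exact hxy
  have hu : l[s-1] ∈ l'.head? := by
    simp only [l']
    rw [List.head?_append, List.head?_reverse, List.getLast?_take, if_neg (by omega)]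
    rw [List.getElem?_eq_getElem (by omega)]
    simp
  have hxu : x ≠ l[s-1] := by
    intro h
    have h0 : l[0] = x := (List.getElem?_eq_some_iff.1 hl0).2
    rw [← h0, hl.1.getElem_inj_iff] at h
    omega
  have hcount := hnb x _ hxu
  have hsub : (G.neighborFinset x ∪ G.neighborFinset l[s-1]) \ {x, l[s-1]} ⊆
      (l.take (i+1)).toFinset \ {x, l[s-1]} := by
    refine Finset.sdiff_subset_sdiff ?_ le_rfl
    intro w hw
    rw [Finset.mem_union, mem_neighborFinset, mem_neighborFinset] at hw
    rw [List.mem_toFinset]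
    rcases hw with hw | hw
    · exact hmem l x hl hlL hx w hw
    · exact (hperm (i+1) (by omega)).mem_iff.1
        (hmem l' _ hl' (hl'p.length_eq.trans hlL) hu w hw)
  have hpair : ({x, l[s-1]} : Finset V) ⊆ (l.take (i+1)).toFinset := by
    have h0 : l[0] = x := (List.getElem?_eq_some_iff.1 hl0).2
    intro w hw
    rw [List.mem_toFinset, List.mem_take_iff_getElem]
    rcases Finset.mem_insert.1 hw with rfl | hw
    · exact ⟨0, by omega, h0⟩
    · exact ⟨s-1, by omega, (Finset.mem_singleton.1 hw).symm⟩
  have h3 := Finset.card_le_card hsub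
  rw [Finset.card_sdiff_of_subset hpair, Finset.card_pair hxu,
    List.toFinset_card_of_nodup (hl.1.sublist (List.take_sublist _ _)), List.length_take] at h3
  refine ⟨l.take (i+1), ⟨hl.1.sublist (List.take_sublist _ _), hl.2.take _, ?_, ?_⟩, ?_⟩
  · rw [List.length_take]; omega
  · intro a ha b hb
    rw [List.getLast?_take, if_neg (by omega)] at ha
    rw [List.head?_take, if_neg (by omega)] at hb
    rw [Option.mem_unique hb hx]
    simp only [Nat.add_sub_cancel] at ha
    rw [Option.mem_def.1 hz] at ha
    simp at ha
    rw [← ha]; exact hxz.symm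
  · rw [List.length_take]; omega

section Cyclic

variable {V : Type*} {G : SimpleGraph V} {m : ℕ} {c : ZMod m → V}

/-- The `k` consecutive values of `c` starting at `i`. -/
def cyclicArc {V : Type*} {m : ℕ} (c : ZMod m → V) (i : ZMod m) (k : ℕ) : List V :=
  (List.range k).map fun j : ℕ => c (i + j)

theorem length_cyclicArc (i : ZMod m) (k : ℕ) : (cyclicArc c i k).length = k := by
  simp [cyclicArc]

theorem head?_cyclicArc (i : ZMod m) (k : ℕ) : (cyclicArc c i (k + 1)).head? = some (c i) := by
  simp [cyclicArc, List.head?_range]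

theorem getLast?_cyclicArc (i : ZMod m) (k : ℕ) :
    (cyclicArc c i (k + 1)).getLast? = some (c (i + k)) := by
  simp [cyclicArc, List.getLast?_range]

theorem mem_cyclicArc {i : ZMod m} {k : ℕ} {v : V} :
    v ∈ cyclicArc c i k ↔ ∃ j < k, c (i + (j : ℕ)) = v := by
  simp [cyclicArc]

theorem natCast_injOn_of_le {k : ℕ} (hk : k ≤ m) {a b : ℕ} (ha : a < k) (hb : b < k)
    (h : (a : ZMod m) = b) : a = b := by
  rw [ZMod.natCast_eq_natCast_iff'] at h
  rwa [Nat.mod_eq_of_lt (by omega), Nat.mod_eq_of_lt (by omega)] at h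

theorem nodup_cyclicArc (hc : Function.Injective c) (i : ZMod m) {k : ℕ} (hk : k ≤ m) :
    (cyclicArc c i k).Nodup := by
  refine List.Nodup.map_on ?_ List.nodup_range
  intro a ha b hb hab
  exact natCast_injOn_of_le hk (List.mem_range.1 ha) (List.mem_range.1 hb)
    (add_left_cancel (hc hab))

theorem isChain_cyclicArc (hadj : ∀ i, G.Adj (c i) (c (i + 1))) (i : ZMod m) (k : ℕ) :
    (cyclicArc c i k).IsChain G.Adj := by
  rw [List.isChain_iff_getElem]
  intro j hj
  simp only [cyclicArc, List.getElem_map, List.getElem_range]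
  have := hadj (i + j)
  rwa [add_assoc, ← Nat.cast_succ] at this

/-- A path of `G` avoiding a longest cycle, whose ends are adjacent to two vertices of the cycle,
is shorter than the arc between them. -/
theorem length_lt_of_longest [NeZero m] (hm : 3 ≤ m) (hc : Function.Injective c)
    (hadj : ∀ i, G.Adj (c i) (c (i + 1)))
    (hmax : ∀ l, IsVertexCycle G l → l.length ≤ m)
    {P : List V} (hnd : P.Nodup) (hch : P.IsChain G.Adj) (hP : ∀ v ∈ P, ∀ i, c i ≠ v)
    {x y : V} (hx : x ∈ P.head?) (hy : y ∈ P.getLast?) {i j : ZMod m} (hij : i ≠ j)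
    (hxi : G.Adj x (c i)) (hyj : G.Adj y (c j)) : P.length < (j - i).val := by
  have hd0 : (j - i).val ≠ 0 := by rw [ZMod.val_ne_zero]; exact sub_ne_zero.2 hij.symm
  have hdm := ZMod.val_lt (j - i)
  set d := (j - i).val with hd
  have hi : j + ((m - d : ℕ) : ZMod m) = i := by
    rw [Nat.cast_sub hdm.le, hd, ZMod.natCast_zmod_val]; simp
  by_contra hlt
  have hcyc : IsVertexCycle G (cyclicArc c j (m - d + 1) ++ P) := by
    refine ⟨?_, ?_, ?_, ?_⟩
    · refine List.Nodup.append (nodup_cyclicArc hc _ (by omega)) hnd ?_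
      intro v hv hvP
      obtain ⟨t, -, ht⟩ := mem_cyclicArc.1 hv
      exact hP v hvP _ ht
    · rw [List.isChain_append]
      refine ⟨isChain_cyclicArc hadj _ _, hch, fun a ha b hb => ?_⟩
      rw [getLast?_cyclicArc, hi, Option.mem_some_iff] at ha
      rw [Option.mem_unique hb hx, ← ha]
      exact hxi.symm
    · rw [List.length_append, length_cyclicArc]; omega
    · intro a ha b hb
      rw [List.head?_append, head?_cyclicArc, Option.some_or, Option.mem_some_iff] at hb
      rw [List.getLast?_append, Option.mem_def.1 hy, Option.some_or, Option.mem_some_iff] at ha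
      rw [← ha, ← hb]; exact hyj
  have := hmax _ hcyc
  rw [List.length_append, length_cyclicArc] at this
  omega

/-- Two vertices outside a longest cycle cannot both be inserted by crossing over between two
equally oriented edges of the cycle. -/
theorem eq_of_crossing [NeZero m] (hc : Function.Injective c)
    (hadj : ∀ i, G.Adj (c i) (c (i + 1)))
    (hmax : ∀ l, IsVertexCycle G l → l.length ≤ m) {x y : V} (hxy : x ≠ y)
    (hx : ∀ i, c i ≠ x) (hy : ∀ i, c i ≠ y) {i j : ZMod m}
    (hxi : G.Adj x (c i)) (hyi : G.Adj y (c (i + 1)))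
    (hxj : G.Adj x (c j)) (hyj : G.Adj y (c (j + 1))) : i = j := by
  by_contra hij
  have hd0 : (j - i).val ≠ 0 := by
    rw [ZMod.val_ne_zero]; exact sub_ne_zero.2 (Ne.symm hij)
  have hdm := ZMod.val_lt (j - i)
  obtain ⟨d, hd⟩ : ∃ d, (j - i).val = d + 1 := ⟨(j - i).val - 1, by omega⟩
  obtain ⟨e, he⟩ : ∃ e, m = (d + 1) + (e + 1) := ⟨m - (d + 2), by omega⟩
  have hj : i + 1 + (d : ZMod m) = j := by
    have h : ((j - i).val : ZMod m) = j - i := ZMod.natCast_zmod_val _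
    rw [hd] at h
    push_cast at h
    linear_combination h
  have hi : j + 1 + (e : ZMod m) = i := by
    have h : ((d + 1 + (e + 1) : ℕ) : ZMod m) = 0 := by rw [← he]; simp
    push_cast at h
    linear_combination h - hj
  have hdisj : ∀ v ∈ cyclicArc c (i + 1) (d + 1), v ∉ cyclicArc c (j + 1) (e + 1) := by
    intro v hv hv'
    obtain ⟨s, hs, hs'⟩ := mem_cyclicArc.1 hv
    obtain ⟨t, ht, ht'⟩ := mem_cyclicArc.1 hv'
    have h := hc (hs'.trans ht'.symm)
    rw [← hj] at h
    have h2 : (s : ZMod m) = ((d + 1 + t : ℕ) : ZMod m) := by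
      push_cast; linear_combination h
    have := natCast_injOn_of_le le_rfl (by omega) (by omega) h2
    omega
  have hxa : ∀ a k, x ∉ cyclicArc c a k := fun a k h => by
    obtain ⟨t, -, ht⟩ := mem_cyclicArc.1 h; exact hx _ ht
  have hya : ∀ a k, y ∉ cyclicArc c a k := fun a k h => by
    obtain ⟨t, -, ht⟩ := mem_cyclicArc.1 h; exact hy _ ht
  have hcyc : IsVertexCycle G
      (cyclicArc c (i + 1) (d + 1) ++ (x :: ((cyclicArc c (j + 1) (e + 1)).reverse ++ [y]))) := by
    refine ⟨?_, ?_, ?_, ?_⟩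
    · refine List.Nodup.append (nodup_cyclicArc hc _ (by omega)) ?_ ?_
      · refine List.nodup_cons.2 ⟨?_, List.Nodup.append
          (List.nodup_reverse.2 (nodup_cyclicArc hc _ (by omega))) (List.nodup_singleton _) ?_⟩
        · simp [hxa, hxy]
        · simp [hya]
      · intro v hv hv'
        simp only [List.mem_cons, List.mem_append, List.mem_reverse, List.not_mem_nil,
          or_false] at hv'
        rcases hv' with rfl | hv' | rfl
        · exact hxa _ _ hv
        · exact hdisj v hv hv'
        · exact hya _ _ hv
    · rw [List.isChain_append]
      refine ⟨isChain_cyclicArc hadj _ _, ?_, ?_⟩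
      · rw [List.isChain_cons, List.isChain_append, List.isChain_reverse]
        refine ⟨?_, (isChain_cyclicArc hadj _ _).imp fun a b h => h.symm, .singleton _, ?_⟩
        · intro a ha
          rw [List.head?_append, List.head?_reverse, getLast?_cyclicArc, Option.some_or,
            Option.mem_some_iff, hi] at ha
          rw [← ha]; exact hxi
        · intro a ha b hb
          rw [List.getLast?_reverse, head?_cyclicArc, Option.mem_some_iff] at ha
          simp only [List.head?_cons, Option.mem_some_iff] at hb
          rw [← ha, ← hb]; exact hyj.symm
      · intro a ha b hb
        rw [getLast?_cyclicArc, Option.mem_some_iff, hj] at ha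
        simp only [List.head?_cons, Option.mem_some_iff] at hb
        rw [← ha, ← hb]; exact hxj.symm
    · simp [length_cyclicArc]; omega
    · intro a ha b hb
      rw [List.head?_append, head?_cyclicArc, Option.some_or, Option.mem_some_iff] at hb
      rw [← List.cons_append, List.getLast?_append, List.getLast?_append] at ha
      simp only [List.getLast?_singleton, Option.some_or, Option.mem_some_iff] at ha
      rw [← ha, ← hb]; exact hyi
  have := hmax _ hcyc
  simp [length_cyclicArc] at this
  omega

/-- The neighbourhoods on a longest cycle of two vertices outside it cover at most one vertex more
than half of the cycle. -/
theorem two_mul_card_union_le [NeZero m] [DecidableRel G.Adj] (hm : 3 ≤ m)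
    (hc : Function.Injective c)
    (hadj : ∀ i, G.Adj (c i) (c (i + 1)))
    (hmax : ∀ l, IsVertexCycle G l → l.length ≤ m) {x y : V} (hxy : x ≠ y)
    (hx : ∀ i, c i ≠ x) (hy : ∀ i, c i ≠ y) :
    2 * (Finset.univ.filter fun i => G.Adj x (c i) ∨ G.Adj y (c i)).card ≤ m + 2 := by
  classical
  set U := Finset.univ.filter fun i => G.Adj x (c i) ∨ G.Adj y (c i) with hU
  have : Fact (1 < m) := ⟨by omega⟩
  have hcons : ∀ z, (∀ i, c i ≠ z) → ∀ i, G.Adj z (c i) → ¬ G.Adj z (c (i + 1)) := by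
    intro z hz i h1 h2
    have := length_lt_of_longest hm hc hadj hmax (P := [z]) (List.nodup_singleton _)
      (.singleton _) (by simpa using hz) (by simp) (by simp) (i := i) (j := i + 1)
      (by simp) h1 h2
    simp [ZMod.val_one] at this
  have hinj : Function.Injective fun i : ZMod m => i + 1 := add_left_injective 1
  have hinter : (U ∩ U.image fun i => i + 1).card ≤ 2 := by
    have hsub : (U ∩ U.image fun i => i + 1) ⊆
        (Finset.univ.filter fun i => G.Adj x (c i) ∧ G.Adj y (c (i + 1))).image (fun i => i + 1) ∪
        (Finset.univ.filter fun i => G.Adj y (c i) ∧ G.Adj x (c (i + 1))).image (fun i => i + 1) := by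
      intro j hj
      obtain ⟨hj, hj'⟩ := Finset.mem_inter.1 hj
      obtain ⟨i, hi, rfl⟩ := Finset.mem_image.1 hj'
      simp only [hU, Finset.mem_filter, Finset.mem_univ, true_and] at hi hj
      simp only [Finset.mem_union, Finset.mem_image, Finset.mem_filter, Finset.mem_univ, true_and]
      have hX := hcons x hx i
      have hY := hcons y hy i
      rcases hi with hi | hi
      · exact .inl ⟨i, ⟨hi, hj.resolve_left (hX hi)⟩, rfl⟩
      · exact .inr ⟨i, ⟨hi, hj.resolve_right (hY hi)⟩, rfl⟩
    refine (Finset.card_le_card hsub).trans ((Finset.card_union_le _ _).trans ?_)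
    rw [Finset.card_image_of_injective _ hinj, Finset.card_image_of_injective _ hinj]
    refine Nat.add_le_add (b := 1) (d := 1) ?_ ?_
    · refine Finset.card_le_one.2 fun i hi j hj => ?_
      simp only [Finset.mem_filter, Finset.mem_univ, true_and] at hi hj
      exact eq_of_crossing hc hadj hmax hxy hx hy hi.1 hi.2 hj.1 hj.2
    · refine Finset.card_le_one.2 fun i hi j hj => ?_
      simp only [Finset.mem_filter, Finset.mem_univ, true_and] at hi hj
      exact eq_of_crossing hc hadj hmax hxy.symm hy hx hi.1 hi.2 hj.1 hj.2
  have h1 := Finset.card_union_add_card_inter U (U.image fun i => i + 1)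
  rw [Finset.card_image_of_injective _ hinj] at h1
  have h2 : (U ∪ U.image fun i => i + 1).card ≤ m :=
    (Finset.card_le_univ _).trans_eq (ZMod.card m)
  omega

end Cyclic

section Gaps

variable {m : ℕ} [NeZero m] {A B : Finset (ZMod m)} {p : ℕ}

theorem exists_gap (hne : A.Nonempty) (hneB : B.Nonempty) (hdisj : Disjoint A B)
    (hAB : ∀ a ∈ A, ∀ b ∈ B, a ≠ b → p < (b - a).val) :
    ∃ a ∈ A, ∀ t : ℕ, 1 ≤ t → t ≤ p → a + t ∉ A ∪ B := by
  obtain ⟨⟨a, b⟩, hab, hmin⟩ := Finset.exists_min_image (A ×ˢ B)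
    (fun q => (q.2 - q.1).val) (hne.product hneB)
  obtain ⟨ha, hb⟩ := Finset.mem_product.1 hab
  have hlt : p < (b - a).val := hAB a ha b hb (fun h => Finset.disjoint_left.1 hdisj ha (h ▸ hb))
  have hbm := ZMod.val_lt (b - a)
  refine ⟨a, ha, fun t ht1 htp hmem => ?_⟩
  have htv : (t : ZMod m).val = t := ZMod.val_natCast_of_lt (by omega)
  rcases Finset.mem_union.1 hmem with h | h
  · have h1 : (b - a).val ≤ (b - (a + t)).val := hmin (a + t, b) (Finset.mem_product.2 ⟨h, hb⟩)
    have h2 : (b - a - t).val = (b - a).val - (t : ZMod m).val := ZMod.val_sub (by omega)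
    rw [sub_sub] at h2
    omega
  · have h1 := hAB a ha _ h (fun h' => Finset.disjoint_left.1 hdisj ha (h' ▸ h))
    rw [add_sub_cancel_left, htv] at h1
    omega

/-- If the elements of `A` and `B` are isolated and every element of `A` is at cyclic distance more
than `p` from every other element of `B`, then the two long gaps of `A ∪ B` bound its size. -/
theorem two_mul_card_union_add_le (hp : 1 ≤ p) (hA : ∀ i ∈ A, i + 1 ∉ A) (hB : ∀ i ∈ B, i + 1 ∉ B)
    (hAB : ∀ a ∈ A, ∀ b ∈ B, a ≠ b → p < (b - a).val ∧ p < (a - b).val)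
    (hne : ∃ a ∈ A, ∃ b ∈ B, a ≠ b) : 2 * (A ∪ B).card + 2 * (p - 1) ≤ m := by
  obtain ⟨a₀, ha₀, b₀, hb₀, hab₀⟩ := hne
  have hpm : p + 1 < m := by
    have := (hAB a₀ ha₀ b₀ hb₀ hab₀).1
    have := ZMod.val_lt (b₀ - a₀)
    omega
  have hval : ∀ t : ℕ, t ≤ p → (t : ZMod m).val = t := fun t ht =>
    ZMod.val_natCast_of_lt (by omega)
  have hcast : ∀ t : ℕ, 1 ≤ t → t < m → (t : ZMod m) ≠ 0 := by
    intro t h1 h2 h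
    have := ZMod.val_natCast_of_lt h2
    rw [h, ZMod.val_zero] at this
    omega
  have hU : ∀ i ∈ A ∪ B, i + 1 ∉ A ∪ B := by
    have h1 : (1 : ZMod m).val = 1 := by simpa using hval 1 hp
    have h10 : (1 : ZMod m) ≠ 0 := by simpa using hcast 1 le_rfl (by omega)
    intro i hi hi'
    rcases Finset.mem_union.1 hi with hi | hi <;> rcases Finset.mem_union.1 hi' with hi' | hi'
    · exact hA i hi hi'
    · have := (hAB i hi _ hi' (by simpa using h10)).1
      rw [add_sub_cancel_left, h1] at this; omega
    · have := (hAB _ hi' _ hi (by simpa using h10)).2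
      rw [add_sub_cancel_left, h1] at this; omega
    · exact hB i hi hi'
  obtain ⟨u, v, hu, hv, huv⟩ : ∃ u v : ZMod m, (∀ t : ℕ, 1 ≤ t → t ≤ p → u + t ∉ A ∪ B) ∧
      (∀ t : ℕ, 1 ≤ t → t ≤ p → v + t ∉ A ∪ B) ∧
      ∀ s t : ℕ, 1 ≤ s → s ≤ p → 1 ≤ t → t ≤ p → u + s ≠ v + t := by
    by_cases hdisj : Disjoint A B
    · obtain ⟨u, hu, hu'⟩ := exists_gap ⟨a₀, ha₀⟩ ⟨b₀, hb₀⟩ hdisj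
        (fun a ha b hb h => (hAB a ha b hb h).1)
      obtain ⟨v, hv, hv'⟩ := exists_gap ⟨b₀, hb₀⟩ ⟨a₀, ha₀⟩ hdisj.symm
        (fun b hb a ha h => (hAB a ha b hb h.symm).2)
      rw [Finset.union_comm] at hv'
      refine ⟨u, v, hu', hv', fun s t hs1 hsp ht1 htp h => ?_⟩
      rcases lt_trichotomy s t with hst | rfl | hst
      · refine hv' (t - s) (by omega) (by omega) ?_
        have : v + ((t - s : ℕ) : ZMod m) = u := by
          rw [Nat.cast_sub hst.le]; linear_combination -h
        rw [this]; exact Finset.mem_union_left _ hu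
      · rw [add_right_cancel h] at hu
        exact Finset.disjoint_left.1 hdisj hu hv
      · refine hu' (s - t) (by omega) (by omega) ?_
        have : u + ((s - t : ℕ) : ZMod m) = v := by
          rw [Nat.cast_sub hst.le]; linear_combination h
        rw [this]; exact Finset.mem_union_right _ hv
    · obtain ⟨s, hsA, hsB⟩ := Finset.not_disjoint_iff.1 hdisj
      have hfar : ∀ w ∈ A ∪ B, w ≠ s → p < (w - s).val ∧ p < (s - w).val := by
        intro w hw hws
        rcases Finset.mem_union.1 hw with hw | hw
        · exact (hAB w hw s hsB hws).symm
        · exact hAB s hsA w hw hws.symm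
      have h2p : 2 * p + 2 ≤ m := by
        obtain ⟨w, hw, hws⟩ : ∃ w ∈ A ∪ B, w ≠ s := by
          by_cases h : a₀ = s
          · exact ⟨b₀, Finset.mem_union_right _ hb₀, fun h' => hab₀ (h.trans h'.symm)⟩
          · exact ⟨a₀, Finset.mem_union_left _ ha₀, h⟩
        obtain ⟨h1, h2⟩ := hfar w hw hws
        have := ZMod.neg_val (w - s)
        rw [neg_sub, if_neg (sub_ne_zero.2 hws)] at this
        omega
      refine ⟨s, s - ((p + 1 : ℕ) : ZMod m), fun t ht1 htp h => ?_, fun t ht1 htp h => ?_, ?_⟩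
      · have := (hfar _ h (by simpa using hcast t ht1 (by omega))).1
        rw [add_sub_cancel_left, hval t htp] at this
        omega
      · have heq : s - ((p + 1 : ℕ) : ZMod m) + t = s - ((p + 1 - t : ℕ) : ZMod m) := by
          rw [Nat.cast_sub (by omega : t ≤ p + 1)]; ring
        rw [heq] at h
        have := (hfar _ h (by simpa using hcast (p + 1 - t) (by omega) (by omega))).2
        rw [sub_sub_cancel, hval _ (by omega)] at this
        omega
      · intro i j hi hip hj hjp h
        refine hcast (i + (p + 1 - j)) (by omega) (by omega) ?_
        rw [Nat.cast_add, Nat.cast_sub (by omega : j ≤ p + 1)]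
        linear_combination h
  have hinj : Function.Injective fun i : ZMod m => i + 1 := add_left_injective 1
  let gap : ZMod m → Finset (ZMod m) := fun u => (Finset.Icc 2 p).image fun t : ℕ => u + t
  have hgap : ∀ u, (gap u).card = p - 1 := by
    intro u
    rw [Finset.card_image_of_injOn, Nat.card_Icc]
    · omega
    · intro s hs t ht h
      have hs := Finset.mem_Icc.1 hs
      have ht := Finset.mem_Icc.1 ht
      have := congrArg ZMod.val (add_left_cancel h)
      rwa [hval s hs.2, hval t ht.2] at this
  have hdisj : ∀ u : ZMod m, (∀ t : ℕ, 1 ≤ t → t ≤ p → u + t ∉ A ∪ B) →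
      Disjoint ((A ∪ B) ∪ (A ∪ B).image fun i => i + 1) (gap u) := by
    intro u hu
    rw [Finset.disjoint_left]
    intro w hw hw'
    obtain ⟨t, ht, rfl⟩ := Finset.mem_image.1 hw'
    have ht := Finset.mem_Icc.1 ht
    rcases Finset.mem_union.1 hw with hw | hw
    · exact hu t (by omega) ht.2 hw
    · obtain ⟨i, hi, h⟩ := Finset.mem_image.1 hw
      refine hu (t - 1) (by omega) (by omega) ?_
      have : u + ((t - 1 : ℕ) : ZMod m) = i := by
        rw [Nat.cast_sub (by omega : 1 ≤ t)]
        push_cast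
        linear_combination -h
      rw [this]; exact hi
  have hgaps : Disjoint (gap u) (gap v) := by
    rw [Finset.disjoint_left]
    intro w hw hw'
    obtain ⟨s, hs, rfl⟩ := Finset.mem_image.1 hw
    obtain ⟨t, ht, h⟩ := Finset.mem_image.1 hw'
    have hs := Finset.mem_Icc.1 hs
    have ht := Finset.mem_Icc.1 ht
    exact huv s t (by omega) hs.2 (by omega) ht.2 h.symm
  have hUdisj : Disjoint (A ∪ B) ((A ∪ B).image fun i => i + 1) := by
    rw [Finset.disjoint_left]
    intro w hw hw'
    obtain ⟨i, hi, rfl⟩ := Finset.mem_image.1 hw'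
    exact hU i hi hw
  have htot : ((((A ∪ B) ∪ (A ∪ B).image fun i => i + 1) ∪ gap u) ∪ gap v).card ≤ m :=
    (Finset.card_le_univ _).trans_eq (ZMod.card m)
  rw [Finset.card_union_of_disjoint (Finset.disjoint_union_left.2 ⟨hdisj v hv, hgaps⟩),
    Finset.card_union_of_disjoint (hdisj u hu), Finset.card_union_of_disjoint hUdisj,
    Finset.card_image_of_injective _ hinj, hgap, hgap] at htot
  omega

end Gaps

/-- A finite graph having a vertex cycle has a longest one, parametrised by `ZMod m`. -/
theorem exists_longest_cyclic {V : Type*} [Fintype V] (G : SimpleGraph V) {l₀ : List V}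
    (h₀ : IsVertexCycle G l₀) :
    ∃ (m : ℕ) (c : ZMod m → V), l₀.length ≤ m ∧ HasCycleLength G m ∧ 3 ≤ m ∧
      Function.Injective c ∧ (∀ i, G.Adj (c i) (c (i + 1))) ∧
      ∀ l, IsVertexCycle G l → l.length ≤ m := by
  classical
  have hbd : ∀ l, IsVertexCycle G l → l.length ≤ Fintype.card V := fun l hl =>
    hl.1.length_le_card
  let Q : ℕ → Prop := fun m => ∃ l, IsVertexCycle G l ∧ l.length = m
  obtain ⟨l, hl, hlm⟩ : Q (Nat.findGreatest Q (Fintype.card V)) :=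
    Nat.findGreatest_spec (hbd _ h₀) ⟨_, h₀, rfl⟩
  have hmax : ∀ l', IsVertexCycle G l' → l'.length ≤ l.length := fun l' hl' => by
    rw [hlm]; exact Nat.le_findGreatest (hbd _ hl') ⟨_, hl', rfl⟩
  have h3 := hl.2.2.1
  have : NeZero l.length := ⟨by omega⟩
  have : Fact (1 < l.length) := ⟨by omega⟩
  refine ⟨l.length, fun i => l[i.val]'(ZMod.val_lt i), hmax _ h₀, hl.hasCycleLength, h3, ?_, ?_,
    hmax⟩
  · intro i j hij
    exact ZMod.val_injective _ ((hl.1.getElem_inj_iff).1 hij)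
  · intro i
    by_cases hi : i.val + 1 < l.length
    · have hv : (i + 1).val = i.val + 1 := by
        rw [ZMod.val_add_of_lt] <;> rw [ZMod.val_one]
        exact hi
      simp only [hv]
      exact List.isChain_iff_getElem.1 hl.2.1 _ hi
    · have hi' : i.val = l.length - 1 := by have := ZMod.val_lt i; omega
      have hv : (i + 1).val = 0 := by
        rw [ZMod.val_add, ZMod.val_one, hi', Nat.sub_add_cancel (by omega), Nat.mod_self]
      simp only [hv, hi']
      refine hl.2.2.2 _ ?_ _ ?_
      · rw [List.getLast?_eq_getElem?, List.getElem?_eq_getElem (by omega)]; rfl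
      · rw [List.head?_eq_getElem?, List.getElem?_eq_getElem (by omega)]; rfl

/-- If all pairs of vertices have large neighbourhood unions, then a longest cycle with more than
half of the vertices misses at most four vertices. -/
theorem card_le_longest_add_four {V : Type*} [Fintype V] [DecidableEq V] (G : SimpleGraph V)
    [DecidableRel G.Adj] {n m : ℕ} (hcard : Fintype.card V = 2 * n) (hδ : ∀ v, 7 ≤ G.degree v)
    (hnb : ∀ u v : V, u ≠ v →
      n - 1 ≤ ((G.neighborFinset u ∪ G.neighborFinset v) \ {u, v}).card)
    {c : ZMod m → V} (hm : 3 ≤ m) (hnm : n + 1 ≤ m) (hc : Function.Injective c)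
    (hadj : ∀ i, G.Adj (c i) (c (i + 1)))
    (hmax : ∀ l, IsVertexCycle G l → l.length ≤ m) : 2 * n ≤ m + 4 := by
  by_contra hlt
  have : NeZero m := ⟨by omega⟩
  let R : Finset V := Finset.univ \ Finset.univ.image c
  have hRmem : ∀ v, v ∈ R ↔ ∀ i, c i ≠ v := by intro v; simp [R]
  have hRcard : R.card = 2 * n - m := by
    rw [Finset.card_univ_sdiff, hcard, Finset.card_image_of_injective _ hc, Finset.card_univ,
      ZMod.card]
  let I : V → Finset (ZMod m) := fun v => Finset.univ.filter fun i => G.Adj v (c i)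
  have hImem : ∀ v i, i ∈ I v ↔ G.Adj v (c i) := by intro v i; simp [I]
  have hsplit : ∀ u v, u ≠ v → ∀ S : Finset V,
      (∀ z ∈ R, z ≠ u → z ≠ v → G.Adj u z ∨ G.Adj v z → z ∈ S) →
      n - 1 ≤ (I u ∪ I v).card + S.card := by
    intro u v huv S hS
    refine (hnb u v huv).trans ?_
    rw [← Finset.card_image_of_injective (I u ∪ I v) hc]
    refine (Finset.card_le_card ?_).trans (Finset.card_union_le _ _)
    intro z hz
    simp only [Finset.mem_sdiff, Finset.mem_union, mem_neighborFinset, Finset.mem_insert,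
      Finset.mem_singleton, not_or] at hz
    by_cases hzR : z ∈ R
    · exact Finset.mem_union_right _ (hS z hzR hz.2.1 hz.2.2 hz.1)
    · rw [hRmem] at hzR
      push Not at hzR
      obtain ⟨i, rfl⟩ := hzR
      refine Finset.mem_union_left _ (Finset.mem_image_of_mem _ ?_)
      rw [Finset.mem_union, hImem, hImem]
      exact hz.1
  have hsplitR : ∀ u ∈ R, ∀ v ∈ R, u ≠ v → n - 1 ≤ (I u ∪ I v).card + (2 * n - m - 2) := by
    intro u hu v hv huv
    have hpair : ({u, v} : Finset V) ⊆ R := by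
      intro z hz
      rcases Finset.mem_insert.1 hz with rfl | hz
      · exact hu
      · rwa [Finset.mem_singleton.1 hz]
    have := hsplit u v huv (R \ {u, v}) (fun z hz h1 h2 _ => by simp [hz, h1, h2])
    rwa [Finset.card_sdiff_of_subset hpair, Finset.card_pair huv, hRcard] at this
  -- at most one vertex off the cycle has no neighbour on it
  let F : Finset V := R.filter fun v => ¬ (I v).Nonempty
  have hFmem : ∀ v, v ∈ F ↔ v ∈ R ∧ ¬ (I v).Nonempty := by intro v; simp [F]
  have hF1 : F.card ≤ 1 := by
    refine Finset.card_le_one.2 fun u hu v hv => ?_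
    by_contra huv
    obtain ⟨huR, hu⟩ := (hFmem u).1 hu
    obtain ⟨hvR, hv⟩ := (hFmem v).1 hv
    have := hsplitR u huR v hvR huv
    rw [Finset.not_nonempty_iff_eq_empty.1 hu, Finset.not_nonempty_iff_eq_empty.1 hv] at this
    simp at this
    omega
  have hF7 : F.Nonempty → 7 ≤ 2 * n - m := by
    rintro ⟨w, hw⟩
    obtain ⟨hwR, hw⟩ := (hFmem w).1 hw
    refine (hδ w).trans ?_
    rw [← card_neighborFinset_eq_degree, ← hRcard]
    refine Finset.card_le_card fun z hz => (hRmem z).2 ?_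
    rintro i rfl
    exact hw ⟨i, (hImem w i).2 ((mem_neighborFinset _ _ _).1 hz)⟩
  let Good : List V → Prop := fun P => P.Nodup ∧ P.IsChain G.Adj ∧ (∀ v ∈ P, v ∈ R) ∧
    2 ≤ P.length ∧ (∀ x ∈ P.head?, (I x).Nonempty) ∧ ∀ y ∈ P.getLast?, (I y).Nonempty
  have hgood : ∃ P, Good P := by
    by_contra hno
    have hW : 1 < (R \ F).card := by
      have hFR : F ⊆ R := Finset.filter_subset _ _
      rw [Finset.card_sdiff_of_subset hFR, hRcard]
      omega
    obtain ⟨x, hx, y, hy, hxy⟩ := Finset.one_lt_card.1 hW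
    have hatt : ∀ x, x ∈ R \ F → x ∈ R ∧ (I x).Nonempty := by
      intro x hx
      obtain ⟨h1, h2⟩ := Finset.mem_sdiff.1 hx
      rw [hFmem] at h2
      exact ⟨h1, by tauto⟩
    obtain ⟨hxR, hxI⟩ := hatt x hx
    obtain ⟨hyR, hyI⟩ := hatt y hy
    have hF : ∀ x ∈ R, (I x).Nonempty → ∀ z ∈ R, G.Adj x z → z ∈ F := by
      intro x hx hxI z hz hxz
      refine (hFmem z).2 ⟨hz, fun hzI => hno ⟨[x, z], ?_⟩⟩
      simp [Good, hx, hxI, hz, hzI, hxz, hxz.ne]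
    have h1 := hsplit x y hxy F fun z hz _ _ h =>
      h.elim (hF x hxR hxI z hz) (hF y hyR hyI z hz)
    have h2 := two_mul_card_union_le hm hc hadj hmax hxy ((hRmem x).1 hxR) ((hRmem y).1 hyR)
    rw [Finset.filter_or] at h2
    change 2 * (I x ∪ I y).card ≤ m + 2 at h2
    rcases F.eq_empty_or_nonempty with hF0 | hF0
    · rw [hF0, Finset.card_empty] at h1
      omega
    · have := hF7 hF0
      omega
  obtain ⟨P, hP, hPmax⟩ : ∃ P, Good P ∧ ∀ P', Good P' → P'.length ≤ P.length := by
    classical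
    obtain ⟨P₀, hP₀⟩ := hgood
    let Q : ℕ → Prop := fun k => ∃ P, Good P ∧ P.length = k
    have hbd : ∀ P, Good P → P.length ≤ Fintype.card V := fun P hP => hP.1.length_le_card
    obtain ⟨P, hP, hPk⟩ : Q (Nat.findGreatest Q (Fintype.card V)) :=
      Nat.findGreatest_spec (hbd _ hP₀) ⟨_, hP₀, rfl⟩
    exact ⟨P, hP, fun P' hP' => hPk ▸ Nat.le_findGreatest (hbd _ hP') ⟨_, hP', rfl⟩⟩
  obtain ⟨hnd, hch, hPR, hp2, hhead, hlast⟩ := hP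
  have hne : P ≠ [] := by rintro rfl; simp at hp2
  obtain ⟨x, hx⟩ : ∃ x, x ∈ P.head? := ⟨_, List.head_mem_head? hne⟩
  obtain ⟨y, hy⟩ : ∃ y, y ∈ P.getLast? := ⟨_, List.getLast_mem_getLast? hne⟩
  have hxI := hhead x hx
  have hyI := hlast y hy
  have hxP : x ∈ P := List.mem_of_mem_head? hx
  have hyP : y ∈ P := List.mem_of_mem_getLast? hy
  have hxy : x ≠ y := by
    rintro rfl
    rw [List.head?_eq_getElem?, Option.mem_def, List.getElem?_eq_some_iff] at hx
    rw [List.getLast?_eq_getElem?, Option.mem_def, List.getElem?_eq_some_iff] at hy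
    obtain ⟨h0, hx⟩ := hx
    obtain ⟨h1, hy⟩ := hy
    have := (hnd.getElem_inj_iff).1 (hx.trans hy.symm)
    omega
  -- by maximality the path contains all attached neighbours of its ends
  have hxnb : ∀ z ∈ R, G.Adj x z → z ∈ P ∨ z ∈ F := by
    intro z hz hxz
    by_contra hcon
    rw [not_or, hFmem] at hcon
    have hzI : (I z).Nonempty := by tauto
    have hgz : Good (z :: P) := by
      refine ⟨List.nodup_cons.2 ⟨hcon.1, hnd⟩, List.isChain_cons.2 ⟨?_, hch⟩, ?_, ?_, ?_, ?_⟩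
      · intro w hw
        rw [Option.mem_unique hw hx]; exact hxz.symm
      · simpa using ⟨hz, hPR⟩
      · rw [List.length_cons]; omega
      · simpa using hzI
      · intro w hw
        rw [List.getLast?_cons_of_ne_nil hne] at hw
        exact hlast w hw
    have := hPmax _ hgz
    rw [List.length_cons] at this
    omega
  have hynb : ∀ z ∈ R, G.Adj y z → z ∈ P ∨ z ∈ F := by
    intro z hz hyz
    by_contra hcon
    rw [not_or, hFmem] at hcon
    have hzI : (I z).Nonempty := by tauto
    have hgz : Good (P ++ [z]) := by
      refine ⟨hnd.append (List.nodup_singleton _) (by simpa using hcon.1),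
        List.isChain_append.2 ⟨hch, .singleton _, ?_⟩, ?_, ?_, ?_, ?_⟩
      · intro w hw w' hw'
        rw [Option.mem_unique hw hy]
        simp at hw'
        exact hw' ▸ hyz
      · intro w hw
        rcases List.mem_append.1 hw with hw | hw
        · exact hPR w hw
        · rwa [List.mem_singleton.1 hw]
      · rw [List.length_append]; omega
      · intro w hw
        rw [List.head?_append_of_ne_nil _ hne] at hw
        exact hhead w hw
      · simpa using hzI
    have := hPmax _ hgz
    rw [List.length_append, List.length_singleton] at this
    omega
  have hdist : ∀ a ∈ I x, ∀ b ∈ I y, a ≠ b → P.length < (b - a).val ∧ P.length < (a - b).val := by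
    intro a ha b hb hab
    refine ⟨length_lt_of_longest hm hc hadj hmax hnd hch (fun v hv => (hRmem v).1 (hPR v hv))
      hx hy hab ((hImem _ _).1 ha) ((hImem _ _).1 hb), ?_⟩
    have := length_lt_of_longest hm hc hadj hmax (List.nodup_reverse.2 hnd)
      (List.isChain_reverse.2 (hch.imp fun _ _ h => h.symm))
      (fun v hv => (hRmem v).1 (hPR v (List.mem_reverse.1 hv)))
      (by rwa [List.head?_reverse]) (by rwa [List.getLast?_reverse])
      hab.symm ((hImem _ _).1 hb) ((hImem _ _).1 ha)
    rwa [List.length_reverse] at this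
  have hisol : ∀ z ∈ R, ∀ i ∈ I z, i + 1 ∉ I z := by
    intro z hz i h1 h2
    have : Fact (1 < m) := ⟨by omega⟩
    have := length_lt_of_longest hm hc hadj hmax (P := [z]) (List.nodup_singleton _)
      (.singleton _) (by simpa using (hRmem z).1 hz) (by simp) (by simp) (i := i) (j := i + 1)
      (by simp) ((hImem _ _).1 h1) ((hImem _ _).1 h2)
    simp [ZMod.val_one] at this
  have hab : ∃ a ∈ I x, ∃ b ∈ I y, a ≠ b := by
    by_contra hcon
    push Not at hcon
    have h1 : (I x ∪ I y).card ≤ 1 := by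
      obtain ⟨a, ha⟩ := hxI
      obtain ⟨b, hb⟩ := hyI
      refine Finset.card_le_one_iff_subset_singleton.2 ⟨a, fun i hi => ?_⟩
      rw [Finset.mem_singleton]
      rcases Finset.mem_union.1 hi with hi | hi
      · rw [hcon i hi b hb, hcon a ha b hb]
      · exact (hcon a ha i hi).symm
    have := hsplitR x (hPR x hxP) y (hPR y hyP) hxy
    omega
  have hcount := two_mul_card_union_add_le (by omega) (hisol x (hPR x hxP)) (hisol y (hPR y hyP))
    hdist hab
  have hfin := hsplit x y hxy ((P.toFinset \ {x, y}) ∪ F) fun z hz hzx hzy h => by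
    rcases h.elim (hxnb z hz) (hynb z hz) with h | h
    · simp [h, hzx, hzy]
    · exact Finset.mem_union_right _ h
  have hpair : ({x, y} : Finset V) ⊆ P.toFinset := by
    intro z hz
    rw [List.mem_toFinset]
    rcases Finset.mem_insert.1 hz with rfl | hz
    · exact hxP
    · rwa [Finset.mem_singleton.1 hz]
  have hcu := Finset.card_union_le (P.toFinset \ {x, y}) F
  rw [Finset.card_sdiff_of_subset hpair, Finset.card_pair hxy,
    List.toFinset_card_of_nodup hnd] at hcu
  omega

theorem stmt_13 {V : Type*} [Fintype V] [DecidableEq V] (G : SimpleGraph V) [DecidableRel G.Adj]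
    (n : ℕ) (hcard : Fintype.card V = 2 * n) (h2 : IsKConnected 2 G)
    (hδ : ∀ v, (n + 1) / 2 + 250 ≤ G.degree v)
    (hnb : ∀ u v : V, u ≠ v →
      n - 1 ≤ ((G.neighborFinset u ∪ G.neighborFinset v) \ {u, v}).card) :
    2 * n - 4 ≤ circumference G := by
  rcases Nat.eq_zero_or_pos n with rfl | hn
  · exact Nat.zero_le _
  have : Nonempty V := Fintype.card_pos_iff.1 (by omega)
  obtain ⟨l, hl, hln⟩ := exists_isVertexCycle_of_union G (n - 1)
    (fun v => by have := hδ v; omega) hnb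
  obtain ⟨m, c, hlm, hcyc, hm, hc, hadj, hmax⟩ := exists_longest_cyclic G hl
  have h4 := card_le_longest_add_four G hcard (fun v => by have := hδ v; omega) hnb hm
    (by omega) hc hadj hmax
  have := le_circumference hcyc
  omega
end

section
/- For every n ≥ 4511 and every even m with n+1 ≤ m ≤ 2n−4008, R(K_{1,n}, C_m) = R(K_{2,n}, C_m), where both are equal to 2n. -/
open SimpleGraph

section Lists

variable {V : Type*}

/-- `l` lists the vertices of a path of `G` from `a` to `b`. -/
structure IsPathList (G : SimpleGraph V) (a b : V) (l : List V) : Prop where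
  nodup : l.Nodup
  chain : l.IsChain G.Adj
  head : l.head? = some a
  last : l.getLast? = some b

namespace IsPathList

variable {G : SimpleGraph V} {a b c d : V} {l l' : List V}

theorem singleton (a : V) : IsPathList G a a [a] := ⟨by simp, by simp, rfl, rfl⟩

theorem ne_nil (h : IsPathList G a b l) : l ≠ [] := by
  rintro rfl; simpa using h.head

theorem append (h : IsPathList G a b l) (h' : IsPathList G c d l') (hbc : G.Adj b c)
    (hd : ∀ x ∈ l, x ∉ l') : IsPathList G a d (l ++ l') := by
  refine ⟨?_, ?_, ?_, ?_⟩
  · rw [List.nodup_append]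
    exact ⟨h.nodup, h'.nodup, fun x hx y hy hxy => hd x hx (hxy ▸ hy)⟩
  · rw [List.isChain_append]
    refine ⟨h.chain, h'.chain, fun x hx y hy => ?_⟩
    rw [h.last] at hx; rw [h'.head] at hy
    cases hx; cases hy; exact hbc
  · rw [List.head?_append, h.head]; rfl
  · rw [List.getLast?_append, h'.last]; rfl

theorem reverse (h : IsPathList G a b l) : IsPathList G b a l.reverse := by
  refine ⟨List.nodup_reverse.2 h.nodup, ?_, ?_, ?_⟩
  · rw [List.isChain_reverse]
    exact h.chain.imp fun x y hxy => hxy.symm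
  · rw [List.head?_reverse, h.last]
  · rw [List.getLast?_reverse, h.head]

theorem cons (h : IsPathList G a b l) (hca : G.Adj c a) (hc : c ∉ l) :
    IsPathList G c b (c :: l) :=
  (singleton c).append h hca (by simpa using hc)

theorem concat (h : IsPathList G a b l) (hbc : G.Adj b c) (hc : c ∉ l) :
    IsPathList G a c (l ++ [c]) :=
  h.append (singleton c) hbc (by
    intro x hx hxc
    rw [List.mem_singleton] at hxc
    exact hc (hxc ▸ hx))

theorem exists_walk (h : IsPathList G a b l) : ∃ w : G.Walk a b, w.support = l := by
  have h1 := h.head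
  have h2 := h.last
  rw [List.head?_eq_some_head h.ne_nil, Option.some_inj] at h1
  rw [List.getLast?_eq_some_getLast h.ne_nil, Option.some_inj] at h2
  exact ⟨(Walk.ofSupport l h.ne_nil h.chain).copy h1 h2, by
    rw [Walk.support_copy, Walk.support_ofSupport]⟩

theorem hasCycleLength (h : IsPathList G a b l) (hba : G.Adj b a) (hl : 3 ≤ l.length) :
    HasCycleLength G l.length := by
  obtain ⟨w, hw⟩ := h.exists_walk
  have hlen : w.length + 1 = l.length := by rw [← hw, Walk.length_support]
  have hp : w.IsPath := by rw [Walk.isPath_def, hw]; exact h.nodup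
  refine ⟨b, Walk.cons hba w, ?_, by simpa using hlen⟩
  rw [Walk.isCycle_iff_isPath_tail_and_le_length]
  refine ⟨by simpa using hp, by simp; omega⟩

end IsPathList

theorem HasCycleLength.exists_map {G : SimpleGraph V} {k : ℕ} (h : HasCycleLength G k) :
    3 ≤ k ∧ ∃ c : ZMod k → V, Function.Injective c ∧ ∀ i, G.Adj (c i) (c (i + 1)) := by
  obtain ⟨v, w, hw, rfl⟩ := h
  have h3 := hw.three_le_length
  refine ⟨h3, ?_⟩
  have : NeZero w.length := ⟨by omega⟩
  refine ⟨fun i => w.getVert i.val, ?_, ?_⟩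
  · intro i j hij
    have hi := ZMod.val_lt i
    have hj := ZMod.val_lt j
    exact ZMod.val_injective _ (hw.getVert_injOn' (by simp; omega) (by simp; omega) hij)
  · intro i
    have hi := ZMod.val_lt i
    have : Fact (1 < w.length) := ⟨by omega⟩
    have : w.getVert (i + 1).val = w.getVert (i.val + 1) := by
      rw [ZMod.val_add, ZMod.val_one]
      rcases Nat.lt_or_ge (i.val + 1) w.length with h | h
      · rw [Nat.mod_eq_of_lt h]
      · have : i.val + 1 = w.length := by omega
        rw [this]; simp
    simp only [this]
    exact w.adj_getVert_succ hi

/-- The `k` consecutive vertices of the closed sequence `c` starting at position `i`. -/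
def arc {ℓ : ℕ} (c : ZMod ℓ → V) (i : ZMod ℓ) (k : ℕ) : List V :=
  (List.range k).map fun t : ℕ => c (i + t)

theorem length_arc {ℓ : ℕ} (c : ZMod ℓ → V) (i : ZMod ℓ) (k : ℕ) : (arc c i k).length = k := by
  simp [arc]

theorem mem_arc {ℓ : ℕ} {c : ZMod ℓ → V} {i : ZMod ℓ} {k : ℕ} {v : V} :
    v ∈ arc c i k ↔ ∃ t < k, c (i + t) = v := by
  simp [arc]

theorem natCast_zmod_inj {ℓ s t : ℕ} (hs : s < ℓ) (ht : t < ℓ) (h : (s : ZMod ℓ) = t) : s = t := by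
  have := congrArg ZMod.val h
  rwa [ZMod.val_natCast_of_lt hs, ZMod.val_natCast_of_lt ht] at this

theorem isPathList_arc {G : SimpleGraph V} {ℓ : ℕ} {c : ZMod ℓ → V} (hc : Function.Injective c)
    (hadj : ∀ i, G.Adj (c i) (c (i + 1))) (i : ZMod ℓ) {k : ℕ} (hk : k + 1 ≤ ℓ) :
    IsPathList G (c i) (c (i + k)) (arc c i (k + 1)) := by
  refine ⟨?_, ?_, ?_, ?_⟩
  · refine List.Nodup.map_on ?_ List.nodup_range
    intro x hx y hy hxy
    rw [List.mem_range] at hx hy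
    exact natCast_zmod_inj (by omega) (by omega) (add_left_cancel (hc hxy))
  · rw [arc, List.isChain_map, List.isChain_range]
    intro m hm
    have := hadj (i + m)
    rwa [add_assoc, ← Nat.cast_succ] at this
  · simp [arc, List.range_succ_eq_map]
  · simp [arc, List.range_succ]

end Lists

section Flexible

variable {V : Type*} [DecidableEq V]

theorem exists_ne_mem_of_card_add_lt {B D : Finset V} (h : D.card + 1 < B.card) :
    ∃ u ∈ B, ∃ u' ∈ B, u ≠ u' ∧ u ∉ D ∧ u' ∉ D := by
  have h1 : 1 < (B \ D).card := by
    have := Finset.le_card_sdiff D B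
    omega
  obtain ⟨u, hu, u', hu', hne⟩ := Finset.one_lt_card.1 h1
  rw [Finset.mem_sdiff] at hu hu'
  exact ⟨u, hu.1, u', hu'.1, hne, hu.2, hu'.2⟩

/-- If the union of two sets exceeds `D` by three, one of them contains two elements outside
`D`. -/
theorem exists_ne_mem_of_card_union {B B' D : Finset V} (h : D.card + 3 ≤ (B ∪ B').card) :
    (∃ u ∈ B, ∃ u' ∈ B, u ≠ u' ∧ u ∉ D ∧ u' ∉ D) ∨
      ∃ u ∈ B', ∃ u' ∈ B', u ≠ u' ∧ u ∉ D ∧ u' ∉ D := by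
  have h1 : 1 < (B \ D).card ∨ 1 < (B' \ D).card := by
    have h2 := Finset.le_card_sdiff D (B ∪ B')
    have h3 := Finset.card_union_le (B \ D) (B' \ D)
    rw [← Finset.union_sdiff_distrib] at h3
    omega
  rcases h1 with h1 | h1 <;> [left; right] <;>
  · obtain ⟨u, hu, u', hu', hne⟩ := Finset.one_lt_card.1 h1
    rw [Finset.mem_sdiff] at hu hu'
    exact ⟨u, hu.1, u', hu'.1, hne, hu.2, hu'.2⟩

variable {G : SimpleGraph V}

/-- Paths of every length up to `A` inside `S`, grown so that the endpoint always keeps two fresh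
continuations and a prescribed set `F` is avoided. -/
theorem exists_isPathList_of_branching {S : Finset V} {B : V → Finset V} {A : ℕ}
    (hB : ∀ z ∈ S, ∀ u ∈ B z, u ∈ S ∧ G.Adj z u)
    (hBB : ∀ z ∈ S, ∀ u ∈ B z, ∀ u' ∈ B z, u ≠ u' → A + 10 ≤ (B u ∪ B u').card)
    {z : V} (hz : z ∈ S) (F : Finset V) (hF : F.card ≤ 3) (hzF : z ∉ F)
    (hBz : 6 ≤ (B z).card) {j : ℕ} (hj : 1 ≤ j) (hjA : j ≤ A) :
    ∃ l p, IsPathList G p z l ∧ l.length = j ∧ p ∈ S ∧ (∀ v ∈ l, v ∈ S ∧ v ∉ F) ∧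
      ∃ u ∈ B p, ∃ u' ∈ B p, u ≠ u' ∧ u ∉ l ∧ u' ∉ l ∧ u ∉ F ∧ u' ∉ F := by
  induction j, hj using Nat.le_induction with
  | base =>
    refine ⟨[z], z, .singleton z, rfl, hz, by simpa using ⟨hz, hzF⟩, ?_⟩
    have hD : (insert z F).card ≤ 4 := (Finset.card_insert_le _ _).trans (by omega)
    obtain ⟨u, hu, u', hu', hne, h1, h2⟩ :=
      exists_ne_mem_of_card_add_lt (B := B z) (D := insert z F) (by omega)
    rw [Finset.mem_insert, not_or] at h1 h2
    exact ⟨u, hu, u', hu', hne, by simpa using h1.1, by simpa using h2.1, h1.2, h2.2⟩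
  | succ j hj ih =>
    obtain ⟨l, p, hl, hlen, hp, hlS, u, hu, u', hu', hne, hul, hu'l, huF, hu'F⟩ := ih (by omega)
    have hD : (l.toFinset ∪ ({u, u'} ∪ F)).card ≤ j + 5 := by
      have h1 := Finset.card_union_le l.toFinset ({u, u'} ∪ F)
      have h2 := Finset.card_union_le {u, u'} F
      have h3 := List.toFinset_card_le l
      have h4 : ({u, u'} : Finset V).card ≤ 2 := Finset.card_le_two
      omega
    have hext : ∀ v ∈ B p, v = u ∨ v = u' → v ∉ l → v ∉ F →
        (∃ w ∈ B v, ∃ w' ∈ B v, w ≠ w' ∧ w ∉ l.toFinset ∪ ({u, u'} ∪ F) ∧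
          w' ∉ l.toFinset ∪ ({u, u'} ∪ F)) →
        ∃ l p, IsPathList G p z l ∧ l.length = j + 1 ∧ p ∈ S ∧ (∀ v ∈ l, v ∈ S ∧ v ∉ F) ∧
          ∃ u ∈ B p, ∃ u' ∈ B p, u ≠ u' ∧ u ∉ l ∧ u' ∉ l ∧ u ∉ F ∧ u' ∉ F := by
      rintro v hv hvu hvl hvF ⟨w, hw, w', hw', hww, h1, h2⟩
      obtain ⟨hvS, hpv⟩ := hB p hp v hv
      simp only [Finset.mem_union, Finset.mem_insert, Finset.mem_singleton, List.mem_toFinset,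
        not_or] at h1 h2
      refine ⟨v :: l, v, hl.cons hpv.symm hvl, by simp [hlen], hvS, ?_, w, hw, w', hw', hww, ?_, ?_,
        h1.2.2, h2.2.2⟩
      · intro x hx
        rcases List.mem_cons.1 hx with rfl | hx
        exacts [⟨hvS, hvF⟩, hlS x hx]
      · rw [List.mem_cons, not_or]
        exact ⟨by rintro rfl; tauto, h1.1⟩
      · rw [List.mem_cons, not_or]
        exact ⟨by rintro rfl; tauto, h2.1⟩
    have hBu := hBB p hp u hu u' hu' hne
    rcases exists_ne_mem_of_card_union (B := B u) (B' := B u')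
      (D := l.toFinset ∪ ({u, u'} ∪ F)) (by omega) with h | h
    · exact hext u hu (.inl rfl) hul huF h
    · exact hext u' hu' (.inr rfl) hu'l hu'F h

variable [Fintype V] [DecidableRel G.Adj]

/-- A flexible set: any two distinct vertices are joined by paths with any number of vertices
between `5` and `A`. -/
theorem exists_isPathList_length {S T : Finset V} {B : V → Finset V} {A θ : ℕ}
    (hB : ∀ z ∈ S, ∀ u ∈ B z, u ∈ S ∧ G.Adj z u) (hB6 : ∀ z ∈ S, 6 ≤ (B z).card)
    (hBT : ∀ z ∈ S, ∀ u ∈ B z, ∀ u' ∈ B z, u ≠ u' →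
      θ ≤ ((G.neighborFinset u ∪ G.neighborFinset u') ∩ T).card)
    (hBB : ∀ z ∈ S, ∀ u ∈ B z, ∀ u' ∈ B z, u ≠ u' → A + 10 ≤ (B u ∪ B u').card)
    (hθ : T.card + A + 10 ≤ 2 * θ) {z z' : V} (hz : z ∈ S) (hz' : z' ∈ S) (hne : z ≠ z')
    {a : ℕ} (ha : 5 ≤ a) (haA : a ≤ A) :
    ∃ l, IsPathList G z z' l ∧ l.length = a ∧ ∀ v ∈ l, v ∈ S ∪ T := by
  obtain ⟨v, hv, v', hv', hvv, hvz, hv'z⟩ :=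
    exists_ne_mem_of_card_add_lt (B := B z') (D := {z}) (by
      have := hB6 z' hz'
      rw [Finset.card_singleton]; omega)
  rw [Finset.mem_singleton] at hvz hv'z
  obtain ⟨l, p, hl, hlen, hp, hlS, u, hu, u', hu', huu, hul, hu'l, huF, hu'F⟩ :=
    exists_isPathList_of_branching hB hBB hz {z', v, v'} Finset.card_le_three
      (by simp only [Finset.mem_insert, Finset.mem_singleton, not_or]
          exact ⟨hne, Ne.symm hvz, Ne.symm hv'z⟩)
      (hB6 z hz) (j := a - 4) (by omega) (by omega)
  have hx : ∃ x ∈ ((G.neighborFinset u ∪ G.neighborFinset u') ∩ T) ∩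
      ((G.neighborFinset v ∪ G.neighborFinset v') ∩ T),
      x ∉ l.toFinset ∪ ({u, u'} ∪ {z', v, v'}) := by
    refine Finset.exists_mem_notMem_of_card_lt_card ?_
    have h1 := Finset.card_union_le l.toFinset ({u, u'} ∪ {z', v, v'})
    have h2 := Finset.card_union_le {u, u'} {z', v, v'}
    have h3 := List.toFinset_card_le l
    have h4 : ({u, u'} : Finset V).card ≤ 2 := Finset.card_le_two
    have h5 : ({z', v, v'} : Finset V).card ≤ 3 := Finset.card_le_three
    have h6 := hBT p hp u hu u' hu' huu
    have h7 := hBT z' hz' v hv v' hv' hvv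
    have h8 := Finset.card_union_add_card_inter
      ((G.neighborFinset u ∪ G.neighborFinset u') ∩ T)
      ((G.neighborFinset v ∪ G.neighborFinset v') ∩ T)
    have h9 : (((G.neighborFinset u ∪ G.neighborFinset u') ∩ T) ∪
      ((G.neighborFinset v ∪ G.neighborFinset v') ∩ T)).card ≤ T.card :=
      Finset.card_le_card (Finset.union_subset Finset.inter_subset_right Finset.inter_subset_right)
    omega
  obtain ⟨x, hx, hxD⟩ := hx
  simp only [Finset.mem_union, Finset.mem_insert, Finset.mem_singleton, List.mem_toFinset,
    not_or, Finset.mem_inter, mem_neighborFinset] at hx hxD huF hu'F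
  obtain ⟨⟨hxu, hxT⟩, hxv, -⟩ := hx
  have key : ∀ u₀ ∈ B p, u₀ ∉ l → u₀ ≠ z' → u₀ ≠ v → u₀ ≠ v' → G.Adj u₀ x → u₀ ≠ x →
      ∀ v₀ ∈ B z', (∀ w ∈ l, w ≠ v₀) → v₀ ≠ z' → u₀ ≠ v₀ → x ≠ v₀ → G.Adj v₀ x →
      ∃ l, IsPathList G z z' l ∧ l.length = a ∧ ∀ v ∈ l, v ∈ S ∪ T := by
    intro u₀ h1 h2 h3 h4 h5 h6 h7 v₀ h8 h9 h10 h11 h12 h13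
    obtain ⟨huS, hpu⟩ := hB p hp u₀ h1
    obtain ⟨hvS, hzv⟩ := hB z' hz' v₀ h8
    have hq : IsPathList G u₀ z' [u₀, x, v₀, z'] :=
      (((IsPathList.singleton z').cons hzv.symm (by simpa using h10)).cons h13.symm
        (by simpa using ⟨h12, hxD.2.2.1⟩)).cons h6 (by simpa using ⟨h7, h11, h3⟩)
    refine ⟨l.reverse ++ [u₀, x, v₀, z'], hl.reverse.append hq hpu ?_, ?_, ?_⟩
    · intro w hw
      rw [List.mem_reverse] at hw
      have hwz : w ≠ z' := by
        have := (hlS w hw).2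
        simp only [Finset.mem_insert, not_or] at this
        exact this.1
      simp only [List.mem_cons, List.not_mem_nil, or_false, not_or]
      exact ⟨fun h => h2 (h ▸ hw), fun h => hxD.1 (h ▸ hw), h9 w hw, hwz⟩
    · simp [hlen]; omega
    · intro w hw
      simp only [List.mem_append, List.mem_reverse, List.mem_cons, List.not_mem_nil,
        or_false] at hw
      rw [Finset.mem_union]
      rcases hw with hw | rfl | rfl | rfl | rfl
      exacts [.inl (hlS w hw).1, .inl huS, .inr hxT, .inl hvS, .inl hz']
  have hlv : ∀ w ∈ l, w ≠ v := fun w hw h => (hlS w hw).2 (by simp [h])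
  have hlv' : ∀ w ∈ l, w ≠ v' := fun w hw h => (hlS w hw).2 (by simp [h])
  have hvz' : v ≠ z' := (hB z' hz' v hv).2.ne'
  have hv'z' : v' ≠ z' := (hB z' hz' v' hv').2.ne'
  rcases hxu with hxu | hxu <;> rcases hxv with hxv | hxv
  · exact key u hu hul huF.1 huF.2.1 huF.2.2 hxu hxu.ne v hv hlv hvz' huF.2.1 hxv.ne' hxv
  · exact key u hu hul huF.1 huF.2.1 huF.2.2 hxu hxu.ne v' hv' hlv' hv'z' huF.2.2 hxv.ne' hxv
  · exact key u' hu' hu'l hu'F.1 hu'F.2.1 hu'F.2.2 hxu hxu.ne v hv hlv hvz' hu'F.2.1 hxv.ne' hxv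
  · exact key u' hu' hu'l hu'F.1 hu'F.2.1 hu'F.2.2 hxu hxu.ne v' hv' hlv' hv'z' hu'F.2.2 hxv.ne'
      hxv

end Flexible

section Auxiliary

variable {V : Type*}

theorem exists_subset_forall_not {S : Finset V} {P : V → Prop}
    (h : ∀ u ∈ S, ∀ v ∈ S, u ≠ v → P u → ¬ P v) :
    ∃ S' ⊆ S, S.card ≤ S'.card + 1 ∧ ∀ v ∈ S', ¬ P v := by
  classical
  refine ⟨S.filter fun v => ¬ P v, Finset.filter_subset _ _, ?_, fun v hv =>
    (Finset.mem_filter.1 hv).2⟩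
  have h1 := Finset.card_filter_add_card_filter_not (s := S) P
  have h2 : (S.filter P).card ≤ 1 := by
    rw [Finset.card_le_one]
    intro a ha b hb
    rw [Finset.mem_filter] at ha hb
    by_contra hab
    exact h a ha.1 b hb.1 hab ha.2 hb.2
  omega

/-- If no label of one vertex is followed at distance `4, 8, …, 4q` by a label of another vertex,
then after deleting few vertices all labels lie in a small set. -/
theorem exists_cover [DecidableEq V] {ℓ q : ℕ} [NeZero ℓ] (hq : 4 * q < ℓ) (S : Finset V)
    (f : V → Finset (ZMod ℓ))
    (h : ∀ r ∈ S, ∀ r' ∈ S, r ≠ r' → ∀ k, 1 ≤ k → k ≤ q → ∀ i ∈ f r,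
      i + ((4 * k : ℕ) : ZMod ℓ) ∉ f r') :
    ∃ S' ⊆ S, ∃ Z : Finset (ZMod ℓ), (S \ S').card * (q + 1) ≤ ℓ ∧ Z.card * (q + 1) ≤ ℓ ∧
      ∀ r ∈ S', f r ⊆ Z := by
  classical
  let 𝓜 : Finset (Finset (V × ZMod ℓ)) := (S ×ˢ Finset.univ).powerset.filter fun M =>
    (∀ p ∈ M, p.2 ∈ f p.1) ∧ (∀ p ∈ M, ∀ p' ∈ M, p.1 = p'.1 → p = p') ∧
      (∀ p ∈ M, ∀ p' ∈ M, p.2 = p'.2 → p = p')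
  obtain ⟨M, hM, hmax⟩ := Finset.exists_max_image 𝓜 Finset.card ⟨∅, by simp [𝓜]⟩
  have hM' := hM
  simp only [𝓜, Finset.mem_filter, Finset.mem_powerset] at hM'
  obtain ⟨hMS, hMf, hM1, hM2⟩ := hM'
  have hS : ∀ p ∈ M, p.1 ∈ S := fun p hp => (Finset.mem_product.1 (hMS hp)).1
  have hcard : M.card * (q + 1) ≤ ℓ := by
    have hinj : Set.InjOn (fun x : (V × ZMod ℓ) × ℕ => x.1.2 + ((4 * x.2 : ℕ) : ZMod ℓ))
        (M ×ˢ Finset.range (q + 1) : Finset _) := by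
      have key : ∀ p ∈ M, ∀ p' ∈ M, ∀ k k', k ≤ k' → k' ≤ q →
          p.2 + ((4 * k : ℕ) : ZMod ℓ) = p'.2 + ((4 * k' : ℕ) : ZMod ℓ) → (p, k) = (p', k') := by
        intro p hp p' hp' k k' hk hk' heq
        obtain ⟨d, rfl⟩ := Nat.exists_eq_add_of_le hk
        rw [mul_add, Nat.cast_add, add_left_comm, add_comm p.2, add_left_cancel_iff] at heq
        rcases Nat.eq_zero_or_pos d with rfl | hd
        · rw [hM2 p hp p' hp' (by simpa using heq)]; rfl
        · exfalso
          by_cases hpp : p = p'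
          · subst hpp
            have h0 : ((4 * d : ℕ) : ZMod ℓ) = ((0 : ℕ) : ZMod ℓ) := by
              rw [Nat.cast_zero]; exact left_eq_add.1 heq
            have := natCast_zmod_inj (by omega) (by omega) h0
            omega
          · refine h p'.1 (hS p' hp') p.1 (hS p hp) ?_ d hd (by omega) p'.2 (hMf p' hp') ?_
            · exact fun h1 => hpp (hM1 p' hp' p hp h1).symm
            · rw [← heq]; exact hMf p hp
      rintro ⟨p, k⟩ hp ⟨p', k'⟩ hp' heq
      simp only [Finset.coe_product, Set.mem_prod, Finset.mem_coe, Finset.mem_range] at hp hp' heq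
      rcases le_total k k' with hk | hk
      · exact key p hp.1 p' hp'.1 k k' hk (by omega) heq
      · exact (key p' hp'.1 p hp.1 k' k hk (by omega) heq.symm).symm
    have := Finset.card_le_card_of_injOn (t := (Finset.univ : Finset (ZMod ℓ))) _
      (fun _ _ => by simp) hinj
    rwa [Finset.card_product, Finset.card_range, Finset.card_univ, ZMod.card] at this
  refine ⟨S \ M.image Prod.fst, Finset.sdiff_subset, M.image Prod.snd, ?_, ?_, ?_⟩
  · refine le_trans (Nat.mul_le_mul_right _ ?_) hcard
    refine (Finset.card_le_card ?_).trans (Finset.card_image_le (f := Prod.fst))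
    intro x hx
    simp only [Finset.mem_sdiff, not_and, not_not] at hx
    exact hx.2 hx.1
  · exact le_trans (Nat.mul_le_mul_right _ Finset.card_image_le) hcard
  · intro r hr i hi
    rw [Finset.mem_sdiff] at hr
    by_contra hiZ
    have hr2 : ∀ p ∈ M, p.1 ≠ r := fun p hp h1 => hr.2 (Finset.mem_image.2 ⟨p, hp, h1⟩)
    have hi2 : ∀ p ∈ M, p.2 ≠ i := fun p hp h1 => hiZ (Finset.mem_image.2 ⟨p, hp, h1⟩)
    have hnot : (r, i) ∉ M := fun hp => hr2 _ hp rfl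
    have := hmax (insert (r, i) M) (by
      simp only [𝓜, Finset.mem_filter, Finset.mem_powerset]
      refine ⟨Finset.insert_subset (by simpa using hr.1) hMS, ?_, ?_, ?_⟩
      · intro p hp
        rcases Finset.mem_insert.1 hp with rfl | hp
        exacts [hi, hMf p hp]
      · intro p hp p' hp' heq
        rcases Finset.mem_insert.1 hp with rfl | hp <;>
          rcases Finset.mem_insert.1 hp' with rfl | hp'
        exacts [rfl, absurd heq.symm (hr2 p' hp'), absurd heq (hr2 p hp), hM1 p hp p' hp' heq]
      · intro p hp p' hp' heq
        rcases Finset.mem_insert.1 hp with rfl | hp <;>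
          rcases Finset.mem_insert.1 hp' with rfl | hp'
        exacts [rfl, absurd heq.symm (hi2 p' hp'), absurd heq (hi2 p hp), hM2 p hp p' hp' heq])
    rw [Finset.card_insert_of_notMem hnot] at this
    omega

/-- Any two distinct vertices of `G` have fewer than `n` common non-neighbours. -/
def FewCommonNonneighbors (G : SimpleGraph V) (n : ℕ) : Prop :=
  ∀ u v, u ≠ v → ∀ S : Finset V,
    (∀ w ∈ S, w ≠ u ∧ w ≠ v ∧ ¬ G.Adj u w ∧ ¬ G.Adj v w) → S.card < n

theorem FewCommonNonneighbors.le_card_union [Fintype V] [DecidableEq V] {G : SimpleGraph V}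
    [DecidableRel G.Adj] {n : ℕ} (h : FewCommonNonneighbors G n) (hV : Fintype.card V = 2 * n)
    {u v : V} (huv : u ≠ v) : n ≤ (G.neighborFinset u ∪ G.neighborFinset v).card + 1 := by
  have h1 := h u v huv (G.neighborFinset u ∪ G.neighborFinset v ∪ {u, v})ᶜ (by
    intro w hw
    simp only [Finset.mem_compl, Finset.mem_union, SimpleGraph.mem_neighborFinset,
      Finset.mem_insert, Finset.mem_singleton, not_or] at hw
    tauto)
  rw [Finset.card_compl, hV] at h1
  have h2 := Finset.card_union_le (G.neighborFinset u ∪ G.neighborFinset v) {u, v}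
  have h3 : ({u, v} : Finset V).card ≤ 2 := Finset.card_le_two
  omega

theorem card_inter_le_of_subset [DecidableEq V] {A S T : Finset V} {k : ℕ} (h : S ⊆ T) (hk : T.card ≤ S.card + k) :
    (A ∩ T).card ≤ (A ∩ S).card + k := by
  have h1 : A ∩ T ⊆ (A ∩ S) ∪ (T \ S) := by
    intro x; simp only [Finset.mem_inter, Finset.mem_union, Finset.mem_sdiff]; tauto
  have h2 := (Finset.card_le_card h1).trans (Finset.card_union_le _ _)
  have h3 := Finset.card_sdiff_add_card_eq_card h
  omega

theorem card_lt_of_separated {G : SimpleGraph V} {n : ℕ} (hf : FewCommonNonneighbors G n) {X Y : Finset V}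
    (hXY : Disjoint X Y) (hno : ∀ x ∈ X, ∀ y ∈ Y, ¬ G.Adj x y) (hY : 2 ≤ Y.card) :
    X.card < n := by
  obtain ⟨y, hy, y', hy', hne⟩ := Finset.one_lt_card.1 hY
  exact hf y y' hne X fun w hw => ⟨fun h => Finset.disjoint_left.1 hXY hw (h ▸ hy),
    fun h => Finset.disjoint_left.1 hXY hw (h ▸ hy'), fun h => hno w hw y hy h.symm,
    fun h => hno w hw y' hy' h.symm⟩

end Auxiliary

section Insertion

variable {V : Type*} {G : SimpleGraph V} {ℓ : ℕ} {c : ZMod ℓ → V} {r r' : V}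

theorem hasCycleLength_of_detour (hc : Function.Injective c)
    (hadj : ∀ i, G.Adj (c i) (c (i + 1))) {l : List V} (hl : IsPathList G r r' l)
    (hlc : ∀ v ∈ l, ∀ i, c i ≠ v) {x : ℕ} (hx : 1 ≤ x) (hxℓ : x < ℓ) (hlen : l.length = x + 1)
    {i : ZMod ℓ} (h1 : G.Adj r (c i)) (h2 : G.Adj r' (c (i + x))) :
    HasCycleLength G (ℓ + 2) := by
  have hP := isPathList_arc hc hadj (i + x) (k := ℓ - x) (by omega)
  have e : i + x + ((ℓ - x : ℕ) : ZMod ℓ) = i := by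
    rw [Nat.cast_sub (by omega), ZMod.natCast_self]; ring
  rw [e] at hP
  have hA := hP.append hl h1.symm (by
    intro v hv hv'
    obtain ⟨t, -, h⟩ := mem_arc.1 hv
    exact hlc v hv' _ h)
  have := hA.hasCycleLength h2 (by rw [List.length_append, length_arc]; omega)
  convert this using 1
  rw [List.length_append, length_arc]; omega

variable [NeZero ℓ]

theorem exists_split (hc : Function.Injective c) (hadj : ∀ i, G.Adj (c i) (c (i + 1)))
    {i j : ZMod ℓ} (hij : i ≠ j) :
    ∃ P Q, IsPathList G (c (i + 1)) (c j) P ∧ IsPathList G (c (j + 1)) (c i) Q ∧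
      P.length + Q.length = ℓ ∧ (∀ v ∈ P, v ∉ Q) ∧ (∀ v ∈ P, ∃ k, c k = v) ∧
      ∀ v ∈ Q, ∃ k, c k = v := by
  obtain ⟨x, hx, hxl, rfl⟩ : ∃ x : ℕ, 1 ≤ x ∧ x < ℓ ∧ j = i + x := by
    refine ⟨(j - i).val, ?_, ZMod.val_lt _, by simp⟩
    rw [Nat.one_le_iff_ne_zero, Ne, ZMod.val_eq_zero, sub_eq_zero]
    exact hij.symm
  have hP := isPathList_arc hc hadj (i + 1) (k := x - 1) (by omega)
  have hQ := isPathList_arc hc hadj (i + x + 1) (k := ℓ - x - 1) (by omega)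
  have e1 : i + 1 + ((x - 1 : ℕ) : ZMod ℓ) = i + x := by
    rw [Nat.cast_sub hx, Nat.cast_one]; ring
  have e2 : i + x + 1 + ((ℓ - x - 1 : ℕ) : ZMod ℓ) = i := by
    rw [Nat.cast_sub (by omega), Nat.cast_sub (by omega), ZMod.natCast_self, Nat.cast_one]; ring
  rw [e1] at hP
  rw [e2] at hQ
  refine ⟨_, _, hP, hQ, ?_, ?_, ?_, ?_⟩
  · rw [length_arc, length_arc]; omega
  · intro v hv hv'
    obtain ⟨t, ht, rfl⟩ := mem_arc.1 hv
    obtain ⟨s, hs, h⟩ := mem_arc.1 hv'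
    have h1 : ((x + s : ℕ) : ZMod ℓ) = t := by
      have := hc h
      rw [Nat.cast_add]
      linear_combination this
    have := natCast_zmod_inj (by omega) (by omega) h1
    omega
  · intro v hv
    obtain ⟨t, -, h⟩ := mem_arc.1 hv
    exact ⟨_, h⟩
  · intro v hv
    obtain ⟨t, -, h⟩ := mem_arc.1 hv
    exact ⟨_, h⟩

theorem hasCycleLength_of_insert_insert (hc : Function.Injective c)
    (hadj : ∀ i, G.Adj (c i) (c (i + 1))) (hr : ∀ i, c i ≠ r) (hr' : ∀ i, c i ≠ r')
    (hrr : r ≠ r') (hℓ : 1 ≤ ℓ) {i j : ZMod ℓ} (hij : i ≠ j) (h1 : G.Adj r (c i))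
    (h2 : G.Adj r (c (i + 1))) (h3 : G.Adj r' (c j)) (h4 : G.Adj r' (c (j + 1))) :
    HasCycleLength G (ℓ + 2) := by
  obtain ⟨P, Q, hP, hQ, hlen, hPQ, hPc, hQc⟩ := exists_split hc hadj hij
  have hrP : r ∉ P := fun h => (hPc r h).elim hr
  have hrQ : r ∉ Q := fun h => (hQc r h).elim hr
  have hrP' : r' ∉ P := fun h => (hPc r' h).elim hr'
  have hrQ' : r' ∉ Q := fun h => (hQc r' h).elim hr'
  have hA := hP.concat h3.symm hrP'
  have hB := hQ.concat h1.symm hrQ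
  have hAB := hA.append hB h4 (by
    intro v hv hv'
    simp only [List.mem_append, List.mem_singleton] at hv hv'
    rcases hv with hv | rfl <;> rcases hv' with hv' | rfl
    exacts [hPQ v hv hv', hrP hv, hrQ' hv', hrr rfl])
  have := hAB.hasCycleLength h2 (by simp; omega)
  convert this using 1
  simp; omega

theorem hasCycleLength_of_cross (hc : Function.Injective c)
    (hadj : ∀ i, G.Adj (c i) (c (i + 1))) (hr : ∀ i, c i ≠ r) (hr' : ∀ i, c i ≠ r')
    (hrr : r ≠ r') (hℓ : 1 ≤ ℓ) {i j : ZMod ℓ} (hij : i ≠ j) (h1 : G.Adj r (c i))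
    (h2 : G.Adj r (c j)) (h3 : G.Adj r' (c (i + 1))) (h4 : G.Adj r' (c (j + 1))) :
    HasCycleLength G (ℓ + 2) := by
  obtain ⟨P, Q, hP, hQ, hlen, hPQ, hPc, hQc⟩ := exists_split hc hadj hij
  have hrP : r ∉ P := fun h => (hPc r h).elim hr
  have hrQ : r ∉ Q := fun h => (hQc r h).elim hr
  have hrP' : r' ∉ P := fun h => (hPc r' h).elim hr'
  have hrQ' : r' ∉ Q := fun h => (hQc r' h).elim hr'
  have hA := hQ.concat h1.symm hrQ
  have hB := hP.reverse.concat h3.symm (by simpa using hrP')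
  have hAB := hA.append hB h2 (by
    intro v hv hv'
    simp only [List.mem_append, List.mem_singleton, List.mem_reverse] at hv hv'
    rcases hv with hv | rfl <;> rcases hv' with hv' | rfl
    exacts [hPQ v hv' hv, hrQ' hv, hrP hv', hrr rfl])
  have := hAB.hasCycleLength h4 (by simp; omega)
  convert this using 1
  simp; omega

end Insertion

section Labels

theorem two_mul_card_le_of_shift {ℓ : ℕ} [NeZero ℓ] {N : Finset (ZMod ℓ)} {k : ℕ}
    (h : (N.filter fun i => i + 1 ∈ N).card ≤ k) : 2 * N.card ≤ ℓ + k := by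
  have h1 : (N.image (· + 1)).card = N.card :=
    Finset.card_image_of_injective _ (add_left_injective 1)
  have h2 := Finset.card_union_add_card_inter (N.image (· + 1)) N
  have h3 := Finset.card_le_univ (N.image (· + 1) ∪ N)
  rw [ZMod.card] at h3
  have h4 : (N.image (· + 1) ∩ N).card ≤ (N.filter fun i => i + 1 ∈ N).card := by
    refine (Finset.card_le_card ?_).trans (Finset.card_image_le (f := (· + 1)))
    intro x hx
    rw [Finset.mem_inter, Finset.mem_image] at hx
    obtain ⟨⟨i, hi, rfl⟩, hx⟩ := hx
    exact Finset.mem_image_of_mem _ (Finset.mem_filter.2 ⟨hi, hx⟩)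
  omega

theorem three_mul_card_le_of_shift {ℓ : ℕ} [NeZero ℓ] {N : Finset (ZMod ℓ)} {k : ℕ}
    (h : (N.filter fun i => i + 1 ∈ N).card ≤ k) (h' : ∀ i ∈ N, i + 2 ∉ N) :
    3 * N.card ≤ ℓ + 2 * k := by
  have h1 : (N.image (· + 1)).card = N.card :=
    Finset.card_image_of_injective _ (add_left_injective 1)
  have h1' : (N.image (· + 2)).card = N.card :=
    Finset.card_image_of_injective _ (add_left_injective 2)
  have h2 := Finset.card_union_add_card_inter (N.image (· + 1)) N
  have h2' := Finset.card_union_add_card_inter (N.image (· + 2)) (N.image (· + 1) ∪ N)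
  have h3 := Finset.card_le_univ (N.image (· + 2) ∪ (N.image (· + 1) ∪ N))
  rw [ZMod.card] at h3
  have h4 : (N.image (· + 1) ∩ N).card ≤ (N.filter fun i => i + 1 ∈ N).card := by
    refine (Finset.card_le_card ?_).trans (Finset.card_image_le (f := (· + 1)))
    intro x hx
    rw [Finset.mem_inter, Finset.mem_image] at hx
    obtain ⟨⟨i, hi, rfl⟩, hx⟩ := hx
    exact Finset.mem_image_of_mem _ (Finset.mem_filter.2 ⟨hi, hx⟩)
  have h5 : (N.image (· + 2) ∩ (N.image (· + 1) ∪ N)).card ≤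
      (N.filter fun i => i + 1 ∈ N).card := by
    refine (Finset.card_le_card ?_).trans (Finset.card_image_le (f := (· + 2)))
    intro x hx
    rw [Finset.mem_inter, Finset.mem_image, Finset.mem_union, Finset.mem_image] at hx
    obtain ⟨⟨i, hi, rfl⟩, ⟨j, hj, hji⟩ | hx⟩ := hx
    · refine Finset.mem_image_of_mem _ (Finset.mem_filter.2 ⟨hi, ?_⟩)
      have : j = i + 1 := by linear_combination hji
      exact this ▸ hj
    · exact absurd hx (h' i hi)
  omega

section

variable {V : Type*} (G : SimpleGraph V) [DecidableRel G.Adj] {ℓ : ℕ} [NeZero ℓ] (c : ZMod ℓ → V)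

/-- The positions of the closed sequence `c` at which it meets the neighbourhood of `r`. -/
def labels (r : V) : Finset (ZMod ℓ) := Finset.univ.filter fun i => G.Adj r (c i)

variable {G c}

theorem mem_labels {r : V} {i : ZMod ℓ} : i ∈ labels G c r ↔ G.Adj r (c i) := by simp [labels]

end

variable {V : Type*} [Fintype V] [DecidableEq V] (G : SimpleGraph V) {ℓ : ℕ} [NeZero ℓ]
  (c : ZMod ℓ → V)

/-- The vertices not on the closed sequence `c`. -/
def outside : Finset V := Finset.univ.filter fun v => ∀ i, c i ≠ v

variable {G c}

theorem mem_outside {v : V} : v ∈ outside c ↔ ∀ i, c i ≠ v := by simp [outside]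

theorem outside_eq_compl : outside c = (Finset.univ.image c)ᶜ := by
  ext v; simp [mem_outside]

theorem card_outside (hc : Function.Injective c) :
    (outside c).card + ℓ = Fintype.card V := by
  have h := Finset.card_compl (Finset.univ.image c)
  have h' := Finset.card_le_univ (Finset.univ.image c)
  rw [Finset.card_image_of_injective _ hc, Finset.card_univ, ZMod.card] at h h'
  rw [outside_eq_compl]; omega

variable (G c)

/-- A cycle `c` of length `ℓ` in a graph on `2n` vertices with few common non-neighbours, such that
there is no cycle of length `ℓ + 2`. -/
structure IsStuckCycle (n : ℕ) : Prop where
  inj : Function.Injective c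
  adj : ∀ i, G.Adj (c i) (c (i + 1))
  stuck : ¬ HasCycleLength G (ℓ + 2)
  few : FewCommonNonneighbors G n
  card : Fintype.card V = 2 * n
  large : 4511 ≤ n
  le_five_mul : n ≤ 5 * ℓ
  add_le : ℓ + 4010 ≤ 2 * n

variable {G c}

theorem IsStuckCycle.card_outside {n : ℕ} (h : IsStuckCycle G c n) : (outside c).card + ℓ = 2 * n := by
  rw [_root_.card_outside h.inj, h.card]

variable [DecidableRel G.Adj]

theorem card_union_le_labels (u v : V) :
    (G.neighborFinset u ∪ G.neighborFinset v).card ≤ (labels G c u ∪ labels G c v).card +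
      ((G.neighborFinset u ∪ G.neighborFinset v) ∩ outside c).card := by
  have h : G.neighborFinset u ∪ G.neighborFinset v ⊆ (labels G c u ∪ labels G c v).image c ∪
      ((G.neighborFinset u ∪ G.neighborFinset v) ∩ outside c) := by
    intro w hw
    by_cases hwo : w ∈ outside c
    · exact Finset.mem_union_right _ (Finset.mem_inter.2 ⟨hw, hwo⟩)
    · rw [mem_outside] at hwo
      push Not at hwo
      obtain ⟨i, rfl⟩ := hwo
      refine Finset.mem_union_left _ (Finset.mem_image_of_mem _ ?_)
      simpa [mem_labels] using hw
  have h1 := Finset.card_le_card h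
  have h2 := Finset.card_union_le ((labels G c u ∪ labels G c v).image c)
    ((G.neighborFinset u ∪ G.neighborFinset v) ∩ outside c)
  have h3 := Finset.card_image_le (s := labels G c u ∪ labels G c v) (f := c)
  omega

namespace IsStuckCycle

variable {n : ℕ}

theorem le_card_inter (h : IsStuckCycle G c n) {u v : V} (huv : u ≠ v) :
    n ≤ (labels G c u ∪ labels G c v).card +
      ((G.neighborFinset u ∪ G.neighborFinset v) ∩ outside c).card + 1 := by
  have h1 := h.few.le_card_union h.card huv
  have h2 := card_union_le_labels (G := G) (c := c) u v
  omega

theorem notMem_labels_of_path (h : IsStuckCycle G c n) {r r' : V} {l : List V}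
    (hl : IsPathList G r r' l) (hlc : ∀ v ∈ l, v ∈ outside c) {x : ℕ} (hx : 1 ≤ x) (hxℓ : x < ℓ)
    (hlen : l.length = x + 1) {i : ZMod ℓ} (hi : i ∈ labels G c r) :
    i + x ∉ labels G c r' := fun hi' =>
  h.stuck (hasCycleLength_of_detour h.inj h.adj hl (fun v hv => mem_outside.1 (hlc v hv)) hx hxℓ
    hlen (mem_labels.1 hi) (mem_labels.1 hi'))

theorem card_shift_le (h : IsStuckCycle G c n) {r r' : V} (hr : r ∈ outside c)
    (hr' : r' ∈ outside c) (hrr : r ≠ r')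
    (h1 : ((labels G c r).filter fun i => i + 1 ∈ labels G c r).card ≤ 1)
    (h2 : ((labels G c r').filter fun i => i + 1 ∈ labels G c r').card ≤ 1)
    {N : Finset (ZMod ℓ)} (hN : N ⊆ labels G c r ∪ labels G c r') :
    (N.filter fun i => i + 1 ∈ N).card ≤ 4 := by
  have key : ∀ s s', s ∈ outside c → s' ∈ outside c → s ≠ s' →
      ((labels G c s).filter fun i => i + 1 ∈ labels G c s').card ≤ 1 := by
    intro s s' hs hs' hss
    rw [Finset.card_le_one]
    intro i hi j hj
    simp only [Finset.mem_filter, mem_labels] at hi hj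
    by_contra hij
    exact h.stuck (hasCycleLength_of_cross h.inj h.adj (mem_outside.1 hs) (mem_outside.1 hs') hss
      (NeZero.one_le) hij hi.1 hj.1 hi.2 hj.2)
  have h3 := key r r' hr hr' hrr
  have h4 := key r' r hr' hr hrr.symm
  have hsub : (N.filter fun i => i + 1 ∈ N) ⊆
      (((labels G c r).filter fun i => i + 1 ∈ labels G c r) ∪
        ((labels G c r').filter fun i => i + 1 ∈ labels G c r')) ∪
      (((labels G c r).filter fun i => i + 1 ∈ labels G c r') ∪
        ((labels G c r').filter fun i => i + 1 ∈ labels G c r)) := by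
    intro i hi
    rw [Finset.mem_filter] at hi
    have h5 := hN hi.1
    have h6 := hN hi.2
    simp only [Finset.mem_union, Finset.mem_filter] at h5 h6 ⊢
    tauto
  refine (Finset.card_le_card hsub).trans ((Finset.card_union_le _ _).trans ?_)
  have h7 := Finset.card_union_le ((labels G c r).filter fun i => i + 1 ∈ labels G c r)
    ((labels G c r').filter fun i => i + 1 ∈ labels G c r')
  have h8 := Finset.card_union_le ((labels G c r).filter fun i => i + 1 ∈ labels G c r')
    ((labels G c r').filter fun i => i + 1 ∈ labels G c r)
  omega

theorem card_union_inter_le (u v : V) (S : Finset V) :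
    ((G.neighborFinset u ∪ G.neighborFinset v) ∩ S).card ≤
      (G.neighborFinset u ∩ S).card + (G.neighborFinset v ∩ S).card := by
  rw [Finset.union_inter_distrib_right]
  exact Finset.card_union_le _ _

theorem exists_regular (h : IsStuckCycle G c n) :
    ∃ R ⊆ outside c, (outside c).card ≤ R.card + 2 ∧ ∀ r ∈ R,
      ((labels G c r).filter fun i => i + 1 ∈ labels G c r).card ≤ 1 ∧
      (outside c).card ≤ 4 * (G.neighborFinset r ∩ outside c).card + 6 := by
  obtain ⟨R, hR, hRc, hR1⟩ := exists_subset_forall_not (S := outside c)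
    (P := fun r => ¬ ((labels G c r).filter fun i => i + 1 ∈ labels G c r).card ≤ 1) (by
      intro u hu v hv huv hPu hPv
      rw [not_le, Finset.one_lt_card] at hPu hPv
      obtain ⟨i, hi, i', hi', hii⟩ := hPu
      obtain ⟨j, hj, j', hj', hjj⟩ := hPv
      simp only [Finset.mem_filter, mem_labels] at hi hi' hj hj'
      have : ∃ k, k ≠ i ∧ G.Adj v (c k) ∧ G.Adj v (c (k + 1)) := by
        by_cases hji : j = i
        · exact ⟨j', fun h => hjj (hji.trans h.symm), hj'⟩
        · exact ⟨j, hji, hj⟩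
      obtain ⟨k, hki, hk⟩ := this
      exact h.stuck (hasCycleLength_of_insert_insert h.inj h.adj (mem_outside.1 hu)
        (mem_outside.1 hv) huv NeZero.one_le (Ne.symm hki) hi.1 hi.2 hk.1 hk.2))
  simp only [not_not] at hR1
  obtain ⟨R', hR', hRc', hR1'⟩ := exists_subset_forall_not (S := R)
    (P := fun r => ¬ (outside c).card ≤ 4 * (G.neighborFinset r ∩ outside c).card + 6) (by
      intro u hu v hv huv hPu hPv
      have h1 := two_mul_card_le_of_shift
        (h.card_shift_le (hR hu) (hR hv) huv (hR1 u hu) (hR1 v hv) subset_rfl)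
      have h2 := h.le_card_inter huv
      have h3 := card_union_inter_le (G := G) u v (outside c)
      have h4 := h.card_outside
      omega)
  simp only [not_not] at hR1'
  exact ⟨R', hR'.trans hR, by omega, fun r hr => ⟨hR1 r (hR' hr), hR1' r hr⟩⟩

end IsStuckCycle

end Labels

section Phases

variable {V : Type*} [Fintype V] [DecidableEq V] {G : SimpleGraph V} [DecidableRel G.Adj]
  {ℓ : ℕ} [NeZero ℓ] {c : ZMod ℓ → V} {n : ℕ}

/-- Among many sets, few have many elements not shared with the other sets. -/
theorem card_filter_private_mul_le (U : Finset V) (f : V → Finset (ZMod ℓ)) (K : ℕ) :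
    (U.filter fun r => K < ((f r).filter fun i => ∀ a ∈ U, i ∈ f a → a = r).card).card * (K + 1)
      ≤ ℓ := by
  have h : (U.biUnion fun r => (f r).filter fun i => ∀ a ∈ U, i ∈ f a → a = r).card ≤ ℓ := by
    refine (Finset.card_le_univ _).trans ?_
    rw [ZMod.card]
  rw [Finset.card_biUnion] at h
  · refine le_trans ?_ h
    refine le_trans ?_ (Finset.sum_le_sum_of_subset (Finset.filter_subset (fun r => K <
      ((f r).filter fun i => ∀ a ∈ U, i ∈ f a → a = r).card) U))
    rw [← smul_eq_mul]
    exact Finset.card_nsmul_le_sum _ _ _ fun r hr => (Finset.mem_filter.1 hr).2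
  · intro r hr r' hr' hne
    rw [Function.onFun, Finset.disjoint_left]
    intro i hi hi'
    rw [Finset.mem_filter] at hi hi'
    exact hne (hi'.2 r hr hi.1)

namespace IsStuckCycle

theorem exists_short_paths (h : IsStuckCycle G c n) :
    ∃ R ⊆ outside c, (outside c).card ≤ R.card + 2 ∧ 200 * ℓ ≤ 303 * n + 1200 ∧
      ∀ z ∈ R, ∀ z' ∈ R, z ≠ z' → ∀ a, 5 ≤ a → a ≤ 97 →
        ∃ l, IsPathList G z z' l ∧ l.length = a ∧ ∀ v ∈ l, v ∈ outside c := by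
  obtain ⟨R, hR, hRc, hR1⟩ := h.exists_regular
  have hcard := h.card_outside
  have hn := h.large
  have hℓ := h.le_five_mul
  have hℓ' := h.add_le
  set K := n / 200 with hK
  let B : V → Finset V := fun z => (G.neighborFinset z ∩ R).filter fun r =>
    ¬ K < ((labels G c r).filter fun i =>
      ∀ a ∈ G.neighborFinset z ∩ R, i ∈ labels G c a → a = r).card
  have hB : ∀ z ∈ R, ∀ u ∈ B z, u ∈ R ∧ G.Adj z u := by
    intro z _ u hu
    have := (Finset.mem_filter.1 hu).1
    rw [Finset.mem_inter, mem_neighborFinset] at this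
    exact this.symm
  have hBc : ∀ z ∈ R, 600 ≤ (B z).card := by
    intro z hz
    have h1 := (hR1 z hz).2
    have h2 := card_inter_le_of_subset (A := G.neighborFinset z) hR hRc
    have h3 := card_filter_private_mul_le (G.neighborFinset z ∩ R) (labels G c) K
    have h4 := Finset.card_filter_add_card_filter_not (s := G.neighborFinset z ∩ R) (fun r =>
      K < ((labels G c r).filter fun i =>
        ∀ a ∈ G.neighborFinset z ∩ R, i ∈ labels G c a → a = r).card)
    change _ + (B z).card = _ at h4
    have h5 : ((G.neighborFinset z ∩ R).filter fun r => K < ((labels G c r).filter fun i =>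
        ∀ a ∈ G.neighborFinset z ∩ R, i ∈ labels G c a → a = r).card).card < 400 := by
      by_contra! hcon
      have := (Nat.mul_le_mul_right (K + 1) hcon).trans h3
      omega
    omega
  have hBT : ∀ z ∈ R, ∀ u ∈ B z, ∀ u' ∈ B z, u ≠ u' → n - 1 - 2 * K - (ℓ + 8) / 3 ≤
      ((G.neighborFinset u ∪ G.neighborFinset u') ∩ outside c).card := by
    intro z hz u hu u' hu' hne
    have huR := (hB z hz u hu).1
    have hu'R := (hB z hz u' hu').1
    rw [Finset.mem_filter] at hu hu'
    set P := (labels G c u).filter fun i =>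
      ∀ a ∈ G.neighborFinset z ∩ R, i ∈ labels G c a → a = u
    set P' := (labels G c u').filter fun i =>
      ∀ a ∈ G.neighborFinset z ∩ R, i ∈ labels G c a → a = u'
    set N := (labels G c u ∪ labels G c u') \ (P ∪ P') with hN
    have hown : ∀ i ∈ N, ∀ b, ∃ a ∈ G.neighborFinset z ∩ R, i ∈ labels G c a ∧ a ≠ b := by
      intro i hi b
      have hex : ∀ v ∈ G.neighborFinset z ∩ R, i ∈ labels G c v →
          (¬ ∀ a ∈ G.neighborFinset z ∩ R, i ∈ labels G c a → a = v) →
          ∃ a ∈ G.neighborFinset z ∩ R, i ∈ labels G c a ∧ a ≠ b := by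
        intro v hv hiv hnot
        push Not at hnot
        obtain ⟨a, ha, hia, hav⟩ := hnot
        by_cases hvb : v = b
        · exact ⟨a, ha, hia, fun h => hav (h.trans hvb.symm)⟩
        · exact ⟨v, hv, hiv, hvb⟩
      simp only [hN, P, P', Finset.mem_sdiff, Finset.mem_union, Finset.mem_filter, not_or,
        not_and] at hi
      rcases hi.1 with h1 | h1
      · exact hex u hu.1 h1 (hi.2.1 h1)
      · exact hex u' hu'.1 h1 (hi.2.2 h1)
    have hN2 : ∀ i ∈ N, i + 2 ∉ N := by
      intro i hi hi'
      obtain ⟨b, hb, hib, -⟩ := hown _ hi' z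
      obtain ⟨a, ha, hia, hab⟩ := hown _ hi b
      rw [Finset.mem_inter, mem_neighborFinset] at ha hb
      have hl : IsPathList G a b [a, z, b] :=
        ((IsPathList.singleton b).cons hb.1 (by simpa using hb.1.ne)).cons ha.1.symm
          (by simpa using ⟨ha.1.ne', hab⟩)
      refine h.notMem_labels_of_path hl ?_ (x := 2) (by omega) (by omega) rfl hia (by simpa using hib)
      intro v hv
      simp only [List.mem_cons, List.not_mem_nil, or_false] at hv
      rcases hv with rfl | rfl | rfl
      exacts [hR ha.2, hR hz, hR hb.2]
    have h1 := three_mul_card_le_of_shift (h.card_shift_le (hR huR) (hR hu'R) hne (hR1 u huR).1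
      (hR1 u' hu'R).1 (N := N) Finset.sdiff_subset) hN2
    have h2 := Finset.le_card_sdiff (P ∪ P') (labels G c u ∪ labels G c u')
    rw [← hN] at h2
    have h3 := Finset.card_union_le P P'
    have h4 := h.le_card_inter hne
    have h5 := hu.2
    have h6 := hu'.2
    omega
  refine ⟨R, hR, hRc, ?_, ?_⟩
  · obtain ⟨z, hz⟩ : R.Nonempty := Finset.card_pos.1 (by omega)
    obtain ⟨u, hu, u', hu', hne⟩ := Finset.one_lt_card.1 (show 1 < (B z).card from
      by have := hBc z hz; omega)
    have h1 := hBT z hz u hu u' hu' hne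
    have h2 := Finset.card_le_card (Finset.inter_subset_right
      (s₁ := G.neighborFinset u ∪ G.neighborFinset u') (s₂ := outside c))
    omega
  · intro z hz z' hz' hne a ha ha'
    obtain ⟨l, hl, hla, hlS⟩ := exists_isPathList_length (A := 97) hB
      (fun z hz => le_trans (by norm_num) (hBc z hz)) hBT (fun z hz u hu u' hu' _ => by
        have h1 := hBc u (hB z hz u hu).1
        have h2 := Finset.card_le_card (Finset.subset_union_left (s₁ := B u) (s₂ := B u'))
        omega) (by omega) hz hz' hne ha ha'
    refine ⟨l, hl, hla, fun v hv => ?_⟩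
    rcases Finset.mem_union.1 (hlS v hv) with h1 | h1
    exacts [hR h1, h1]

theorem exists_cover_of_paths (h : IsStuckCycle G c n) {S : Finset V} {q : ℕ}
    (hq : 4 * q < ℓ) (hS : ∀ z ∈ S, ∀ z' ∈ S, z ≠ z' → ∀ a, 5 ≤ a → a ≤ 4 * q + 1 →
      ∃ l, IsPathList G z z' l ∧ l.length = a ∧ ∀ v ∈ l, v ∈ outside c) :
    ∃ S' ⊆ S, ∃ Z : Finset (ZMod ℓ), (S \ S').card * (q + 1) ≤ ℓ ∧ Z.card * (q + 1) ≤ ℓ ∧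
      ∀ r ∈ S', labels G c r ⊆ Z := by
  refine exists_cover hq S _ fun r hr r' hr' hne k hk hkq i hi => ?_
  obtain ⟨l, hl, hlen, hlo⟩ := hS r hr r' hr' hne (4 * k + 1) (by omega) (by omega)
  exact h.notMem_labels_of_path hl hlo (by omega) (by omega) hlen hi

theorem exists_separation (h : IsStuckCycle G c n) :
    ∃ X Y : Finset V, Disjoint X Y ∧ (∀ x ∈ X, ∀ y ∈ Y, ¬ G.Adj x y) ∧ 2 ≤ X.card ∧ 2 ≤ Y.card ∧
      31 * n ≤ 16 * (X.card + Y.card) ∧ ℓ ≤ X.card + 29 := by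
  obtain ⟨R, hR, hRc, hℓ3, hRp⟩ := h.exists_short_paths
  have hcard := h.card_outside
  have hn := h.large
  have hℓ := h.le_five_mul
  have hℓ' := h.add_le
  obtain ⟨R₂, hR₂, Z₂, hR₂c, hZ₂c, hZ₂⟩ := h.exists_cover_of_paths (q := 24) (by omega) hRp
  have hR₂c' := Finset.card_sdiff_add_card_eq_card hR₂
  have hθ : ∀ u ∈ R₂, ∀ v ∈ R₂, u ≠ v → n - 1 - ℓ / 25 ≤
      ((G.neighborFinset u ∪ G.neighborFinset v) ∩ outside c).card := by
    intro u hu v hv huv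
    have h1 := h.le_card_inter huv
    have h2 := Finset.card_le_card (Finset.union_subset (hZ₂ u hu) (hZ₂ v hv))
    omega
  have hℓ4 : n - 1 - ℓ / 25 ≤ (outside c).card := by
    obtain ⟨u, hu, u', hu', hne⟩ := Finset.one_lt_card.1 (show 1 < R₂.card by omega)
    exact (hθ u hu u' hu' hne).trans (Finset.card_le_card Finset.inter_subset_right)
  obtain ⟨S, hS, hSc, hSd⟩ := exists_subset_forall_not (S := R₂)
    (P := fun r => 2 * (G.neighborFinset r ∩ outside c).card < n - 1 - ℓ / 25) (by
      intro u hu v hv huv hPu hPv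
      have h1 := hθ u hu v hv huv
      have h2 := card_union_inter_le (G := G) u v (outside c)
      omega)
  have hSR : S ⊆ outside c := (hS.trans hR₂).trans hR
  have hSRc : (outside c).card ≤ S.card + (3 + ℓ / 25) := by omega
  set q := n / 28 with hq
  obtain ⟨Y, hY, Z, hYc, hZc, hZ⟩ := h.exists_cover_of_paths (S := S) (q := q) (by omega) (by
    intro z hz z' hz' hne a ha ha'
    obtain ⟨l, hl, hla, hlS⟩ := exists_isPathList_length (S := S) (T := outside c)
      (B := fun z => G.neighborFinset z ∩ S) (θ := n - 1 - ℓ / 25) (A := 4 * q + 1)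
      (fun z hz u hu => by
        rw [Finset.mem_inter, mem_neighborFinset] at hu; exact hu.symm)
      (fun z hz => by
        have h1 := hSd z hz
        have h2 := card_inter_le_of_subset (A := G.neighborFinset z) hSR hSRc
        omega)
      (fun z hz u hu u' hu' huu => hθ u (hS (Finset.mem_inter.1 hu).2) u'
        (hS (Finset.mem_inter.1 hu').2) huu)
      (fun z hz u hu u' hu' huu => by
        have h1 := hθ u (hS (Finset.mem_inter.1 hu).2) u' (hS (Finset.mem_inter.1 hu').2) huu
        have h2 := card_inter_le_of_subset (A := G.neighborFinset u ∪ G.neighborFinset u') hSR hSRc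
        rw [← Finset.union_inter_distrib_right]
        omega)
      (by omega) hz hz' hne ha ha'
    refine ⟨l, hl, hla, fun v hv => ?_⟩
    rcases Finset.mem_union.1 (hlS v hv) with h1 | h1
    exacts [hSR h1, h1])
  have hYc' := Finset.card_sdiff_add_card_eq_card hY
  have hbound : ∀ x, x * (q + 1) ≤ ℓ → x ≤ 29 := by
    intro x hx
    by_contra! hcon
    have := (Nat.mul_le_mul_right (q + 1) hcon).trans hx
    omega
  have hY29 := hbound _ hYc
  have hZ29 := hbound _ hZc
  have hX : (Zᶜ.image c).card = ℓ - Z.card := by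
    rw [Finset.card_image_of_injective _ h.inj, Finset.card_compl, ZMod.card]
  refine ⟨Zᶜ.image c, Y, ?_, ?_, by omega, by omega, by omega, by omega⟩
  · rw [Finset.disjoint_left]
    intro x hx hxY
    obtain ⟨i, -, rfl⟩ := Finset.mem_image.1 hx
    exact mem_outside.1 (hSR (hY hxY)) i rfl
  · intro x hx y hy hxy
    obtain ⟨i, hi, rfl⟩ := Finset.mem_image.1 hx
    exact Finset.mem_compl.1 hi (hZ y hy (mem_labels.2 hxy.symm))

end IsStuckCycle

end Phases

section Separated

variable {V : Type*} [Fintype V] [DecidableEq V] {G : SimpleGraph V} [DecidableRel G.Adj] {n : ℕ}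

theorem exists_two_cross_edges (hf : FewCommonNonneighbors G n) (hV : Fintype.card V = 2 * n)
    {P Q : Finset V} (hPQ : Disjoint P Q) (hcard : 2 * n ≤ P.card + Q.card + 1)
    (hlow : ∀ v, v ∉ P → v ∉ Q → 2 * G.degree v + 1 < n) (hQ : 4 ≤ Q.card)
    (hQP : Q.card ≤ P.card) :
    ∃ x ∈ P, ∃ x' ∈ P, ∃ y ∈ Q, ∃ y' ∈ Q, x ≠ x' ∧ y ≠ y' ∧ G.Adj x y ∧ G.Adj x' y' := by
  by_contra! hcon
  have hdisj := fun v (hv : v ∈ P) (hv' : v ∈ Q) => Finset.disjoint_left.1 hPQ hv hv'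
  obtain ⟨Q₁, hQ₁, hQ₁c, hQ₁n⟩ := exists_subset_forall_not (S := Q)
    (P := fun y => ∀ x ∈ P, ¬ G.Adj x y) (by
      intro u hu v hv huv hPu hPv
      have := hf u v huv P fun w hw => ⟨fun h => hdisj w hw (h ▸ hu), fun h => hdisj w hw (h ▸ hv),
        fun h => hPu w hw h.symm, fun h => hPv w hw h.symm⟩
      omega)
  obtain ⟨y₁, hy₁, y₂, hy₂, hyy⟩ := Finset.one_lt_card.1 (show 1 < Q₁.card by omega)
  have h1 := hQ₁n y₁ hy₁
  have h2 := hQ₁n y₂ hy₂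
  push Not at h1 h2
  obtain ⟨x₀, hx₀, hxy₁⟩ := h1
  obtain ⟨x₂, hx₂, hxy₂⟩ := h2
  have hx₂₀ : x₂ = x₀ := by
    by_contra hne
    exact hcon x₂ hx₂ x₀ hx₀ y₂ (hQ₁ hy₂) y₁ (hQ₁ hy₁) hne hyy.symm hxy₂ hxy₁
  subst hx₂₀
  have honly : ∀ x ∈ P, ∀ y ∈ Q, G.Adj x y → x = x₂ := by
    intro x hx y hy hxy
    by_contra hne
    by_cases h : y = y₁
    · exact hcon x hx x₂ hx₂ y hy y₂ (hQ₁ hy₂) hne (fun h' => hyy (h.symm.trans h')) hxy hxy₂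
    · exact hcon x hx x₂ hx₂ y hy y₁ (hQ₁ hy₁) hne h hxy hxy₁
  have hPn := hf y₁ y₂ hyy (P.erase x₂) (by
    intro w hw
    obtain ⟨hne, hw⟩ := Finset.mem_erase.1 hw
    exact ⟨fun h => hdisj w hw (h ▸ hQ₁ hy₁), fun h => hdisj w hw (h ▸ hQ₁ hy₂),
      fun h => hne (honly w hw _ (hQ₁ hy₁) h.symm), fun h => hne (honly w hw _ (hQ₁ hy₂) h.symm)⟩)
  rw [Finset.card_erase_of_mem hx₂] at hPn
  have hcompl : Pᶜ.card = n := by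
    rw [Finset.card_compl, hV]; omega
  have hL : (P ∪ Q)ᶜ.card ≤ 1 := by
    rw [Finset.card_compl, Finset.card_union_of_disjoint hPQ, hV]; omega
  have hfree : ∃ u ∈ P, ∃ u' ∈ P, u ≠ u' ∧ (u ≠ x₂ ∧ ∀ v ∈ (P ∪ Q)ᶜ, ¬ G.Adj u v) ∧
      (u' ≠ x₂ ∧ ∀ v ∈ (P ∪ Q)ᶜ, ¬ G.Adj u' v) := by
    rcases Finset.eq_empty_or_nonempty (P ∪ Q)ᶜ with h | ⟨v, hv⟩
    · obtain ⟨u, hu, u', hu', hne, h1, h2⟩ := exists_ne_mem_of_card_add_lt (B := P) (D := {x₂})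
        (by rw [Finset.card_singleton]; omega)
      rw [Finset.mem_singleton] at h1 h2
      exact ⟨u, hu, u', hu', hne, ⟨h1, by simp [h]⟩, ⟨h2, by simp [h]⟩⟩
    · have hv' := hv
      rw [Finset.mem_compl, Finset.mem_union, not_or] at hv'
      have hd := hlow v hv'.1 hv'.2
      obtain ⟨u, hu, u', hu', hne, h1, h2⟩ := exists_ne_mem_of_card_add_lt (B := P)
        (D := insert x₂ (G.neighborFinset v)) (by
          have := Finset.card_insert_le x₂ (G.neighborFinset v)
          rw [card_neighborFinset_eq_degree] at this
          omega)
      rw [Finset.mem_insert, not_or, mem_neighborFinset] at h1 h2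
      refine ⟨u, hu, u', hu', hne, ⟨h1.1, fun x hx h => ?_⟩, ⟨h2.1, fun x hx h => ?_⟩⟩
      · exact h1.2 (Finset.card_le_one.1 hL x hx v hv ▸ h.symm)
      · exact h2.2 (Finset.card_le_one.1 hL x hx v hv ▸ h.symm)
  obtain ⟨u, hu, u', hu', hne, h1, h2⟩ := hfree
  have hnon : ∀ u ∈ P, u ≠ x₂ → (∀ v ∈ (P ∪ Q)ᶜ, ¬ G.Adj u v) → ∀ w ∈ Pᶜ, ¬ G.Adj u w := by
    intro u hu hux huv w hw huw
    by_cases hwQ : w ∈ Q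
    · exact hux (honly u hu w hwQ huw)
    · refine huv w ?_ huw
      rw [Finset.mem_compl] at hw ⊢
      rw [Finset.mem_union, not_or]
      exact ⟨hw, hwQ⟩
  have := hf u u' hne Pᶜ (by
    intro w hw
    refine ⟨?_, ?_, hnon u hu h1.1 h1.2 w hw, hnon u' hu' h2.1 h2.2 w hw⟩
    · rintro rfl; exact Finset.mem_compl.1 hw hu
    · rintro rfl; exact Finset.mem_compl.1 hw hu')
  omega

theorem exists_paths_of_side (hf : FewCommonNonneighbors G n) (hV : Fintype.card V = 2 * n)
    (hn : 4511 ≤ n) {X Y W S : Finset V} (hXY : Disjoint X Y)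
    (hno : ∀ x ∈ X, ∀ y ∈ Y, ¬ G.Adj x y) (hXYc : 31 * n ≤ 16 * (X.card + Y.card))
    (hW : 2 * n ≤ W.card + 1) (hX : X.card < n) (hXS : X ∩ W ⊆ S)
    (hS : ∀ z ∈ S, 6 ≤ (G.neighborFinset z ∩ (X ∩ W)).card)
    {z z' : V} (hz : z ∈ S) (hz' : z' ∈ S) (hne : z ≠ z') {a : ℕ} (ha : 5 ≤ a)
    (ha' : a ≤ n / 2 + 25) :
    ∃ l, IsPathList G z z' l ∧ l.length = a ∧ ∀ v ∈ l, v ∈ S := by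
  have hWc : Wᶜ.card ≤ 1 := by rw [Finset.card_compl, hV]; omega
  have hXYc' : 16 * (X ∪ Y)ᶜ.card ≤ n := by
    rw [Finset.card_compl, Finset.card_union_of_disjoint hXY, hV]; omega
  have hθ : ∀ u ∈ X ∩ W, ∀ u' ∈ X ∩ W, u ≠ u' → n - 2 - n / 16 ≤
      ((G.neighborFinset u ∪ G.neighborFinset u') ∩ (X ∩ W)).card := by
    intro u hu u' hu' huu
    have h1 := hf.le_card_union hV huu
    have hsub : G.neighborFinset u ∪ G.neighborFinset u' ⊆
        (G.neighborFinset u ∪ G.neighborFinset u') ∩ (X ∩ W) ∪ ((X ∪ Y)ᶜ ∪ Wᶜ) := by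
      intro v hv
      have hvY : v ∉ Y := by
        intro hvY
        rw [Finset.mem_union, mem_neighborFinset, mem_neighborFinset] at hv
        rcases hv with hv | hv
        · exact hno u (Finset.mem_inter.1 hu).1 v hvY hv
        · exact hno u' (Finset.mem_inter.1 hu').1 v hvY hv
      simp only [Finset.mem_union, Finset.mem_inter, Finset.mem_compl] at hv ⊢
      tauto
    have h2 := (Finset.card_le_card hsub).trans (Finset.card_union_le _ _)
    have h3 := Finset.card_union_le (X ∪ Y)ᶜ Wᶜ
    omega
  have hXW := Finset.card_le_card (Finset.inter_subset_left (s₁ := X) (s₂ := W))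
  obtain ⟨l, hl, hla, hlS⟩ := exists_isPathList_length (G := G) (S := S) (T := X ∩ W)
    (B := fun z => G.neighborFinset z ∩ (X ∩ W)) (A := n / 2 + 25) (θ := n - 2 - n / 16)
    (fun z _ u hu => by
      rw [Finset.mem_inter, mem_neighborFinset] at hu
      exact ⟨hXS hu.2, hu.1⟩) hS
    (fun z _ u hu u' hu' huu => hθ u (Finset.mem_inter.1 hu).2 u' (Finset.mem_inter.1 hu').2 huu)
    (fun z _ u hu u' hu' huu => by
      have := hθ u (Finset.mem_inter.1 hu).2 u' (Finset.mem_inter.1 hu').2 huu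
      rw [← Finset.union_inter_distrib_right]
      omega)
    (by omega) hz hz' hne ha ha'
  refine ⟨l, hl, hla, fun v hv => ?_⟩
  rcases Finset.mem_union.1 (hlS v hv) with h | h
  exacts [h, hXS h]

theorem hasCycleLength_of_separated (hf : FewCommonNonneighbors G n)
    (hV : Fintype.card V = 2 * n) (hn : 4511 ≤ n) {X Y : Finset V} (hXY : Disjoint X Y)
    (hno : ∀ x ∈ X, ∀ y ∈ Y, ¬ G.Adj x y) (hX : 2 ≤ X.card) (hY : 2 ≤ Y.card)
    (hXYc : 31 * n ≤ 16 * (X.card + Y.card)) {j : ℕ} (hj : n + 1 ≤ j) (hj' : j ≤ n + 40) :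
    HasCycleLength G j := by
  have hno' : ∀ y ∈ Y, ∀ x ∈ X, ¬ G.Adj y x := fun y hy x hx h => hno x hx y hy h.symm
  have hXn := card_lt_of_separated hf hXY hno hY
  have hYn := card_lt_of_separated hf hXY.symm hno' hX
  set W : Finset V := Finset.univ.filter fun v => ¬ 2 * G.degree v + 1 < n with hWdef
  have hW : 2 * n ≤ W.card + 1 := by
    obtain ⟨S, -, hSc, hS⟩ := exists_subset_forall_not (S := (Finset.univ : Finset V))
      (P := fun v => 2 * G.degree v + 1 < n) (by
        intro u _ v _ huv hu hv
        have h1 := hf.le_card_union hV huv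
        have h2 := Finset.card_union_le (G.neighborFinset u) (G.neighborFinset v)
        rw [card_neighborFinset_eq_degree, card_neighborFinset_eq_degree] at h2
        omega)
    have : S ⊆ W := fun v hv => Finset.mem_filter.2 ⟨Finset.mem_univ _, hS v hv⟩
    have := Finset.card_le_card this
    rw [Finset.card_univ, hV] at hSc
    omega
  have hWc : Wᶜ.card ≤ 1 := by rw [Finset.card_compl, hV]; omega
  have hXYc' : 16 * (X ∪ Y)ᶜ.card ≤ n := by
    rw [Finset.card_compl, Finset.card_union_of_disjoint hXY, hV]; omega
  have hdeg : ∀ v ∈ W, n ≤ 2 * ((G.neighborFinset v ∩ (X ∩ W)).card +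
      (G.neighborFinset v ∩ (Y ∩ W)).card + n / 16 + 1) + 1 := by
    intro v hv
    have h1 := (Finset.mem_filter.1 hv).2
    have hsub : G.neighborFinset v ⊆ (G.neighborFinset v ∩ (X ∩ W) ∪
        G.neighborFinset v ∩ (Y ∩ W)) ∪ ((X ∪ Y)ᶜ ∪ Wᶜ) := by
      intro x hx
      simp only [Finset.mem_union, Finset.mem_inter, Finset.mem_compl]
      tauto
    have h2 := (Finset.card_le_card hsub).trans (Finset.card_union_le _ _)
    have h3 := Finset.card_union_le (X ∪ Y)ᶜ Wᶜ
    have h4 := Finset.card_union_le (G.neighborFinset v ∩ (X ∩ W)) (G.neighborFinset v ∩ (Y ∩ W))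
    rw [card_neighborFinset_eq_degree] at h2
    omega
  set P : Finset V := W.filter fun v => 6 ≤ (G.neighborFinset v ∩ (X ∩ W)).card with hP
  set Q : Finset V := W.filter fun v => ¬ 6 ≤ (G.neighborFinset v ∩ (X ∩ W)).card with hQ
  have hempty : ∀ A B : Finset V, (∀ x ∈ A, ∀ y ∈ B, ¬ G.Adj x y) → ∀ v ∈ A,
      (G.neighborFinset v ∩ (B ∩ W)).card = 0 := by
    intro A B hAB v hv
    rw [Finset.card_eq_zero, Finset.eq_empty_iff_forall_notMem]
    intro x hx
    simp only [Finset.mem_inter, mem_neighborFinset] at hx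
    exact hAB v hv x hx.2.1 hx.1
  have hXP : X ∩ W ⊆ P := by
    intro v hv
    rw [Finset.mem_inter] at hv
    refine Finset.mem_filter.2 ⟨hv.2, ?_⟩
    have h1 := hdeg v hv.2
    have h2 := hempty X Y hno v hv.1
    omega
  have hYQ : Y ∩ W ⊆ Q := by
    intro v hv
    rw [Finset.mem_inter] at hv
    refine Finset.mem_filter.2 ⟨hv.2, ?_⟩
    have h2 := hempty Y X hno' v hv.1
    omega
  have hPQ : Disjoint P Q := Finset.disjoint_filter_filter_not _ _ _
  have hPQc : P.card + Q.card = W.card := Finset.card_filter_add_card_filter_not _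
  have hP6 : ∀ z ∈ P, 6 ≤ (G.neighborFinset z ∩ (X ∩ W)).card :=
    fun z hz => (Finset.mem_filter.1 hz).2
  have hQ6 : ∀ z ∈ Q, 6 ≤ (G.neighborFinset z ∩ (Y ∩ W)).card := by
    intro z hz
    have h1 := Finset.mem_filter.1 hz
    have h2 := hdeg z h1.1
    omega
  have hlow : ∀ v, v ∉ P → v ∉ Q → 2 * G.degree v + 1 < n := by
    intro v hvP hvQ
    by_contra hv
    have hvW : v ∈ W := Finset.mem_filter.2 ⟨Finset.mem_univ _, hv⟩
    rw [hP, Finset.mem_filter] at hvP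
    rw [hQ, Finset.mem_filter] at hvQ
    tauto
  have hinter : ∀ A : Finset V, A.card ≤ (A ∩ W).card + 1 := by
    intro A
    have h1 := Finset.card_inter_add_card_sdiff A W
    have h2 : (A \ W).card ≤ Wᶜ.card :=
      Finset.card_le_card fun x hx => Finset.mem_compl.2 (Finset.mem_sdiff.1 hx).2
    omega
  have hcross : ∃ x ∈ P, ∃ x' ∈ P, ∃ y ∈ Q, ∃ y' ∈ Q, x ≠ x' ∧ y ≠ y' ∧ G.Adj x y ∧
      G.Adj x' y' := by
    have h1 := Finset.card_le_card hXP
    have h2 := Finset.card_le_card hYQ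
    have h3 := hinter X
    have h4 := hinter Y
    rcases le_total Q.card P.card with h | h
    · exact exists_two_cross_edges hf hV hPQ (by omega) hlow (by omega) h
    · obtain ⟨y, hy, y', hy', x, hx, x', hx', hyy, hxx, hyx, hyx'⟩ :=
        exists_two_cross_edges hf hV hPQ.symm (by omega) (fun v h1 h2 => hlow v h2 h1)
          (by omega) h
      exact ⟨x, hx, x', hx', y, hy, y', hy', hxx, hyy, hyx.symm, hyx'.symm⟩
  obtain ⟨x, hx, x', hx', y, hy, y', hy', hxx, hyy, hxy, hxy'⟩ := hcross
  obtain ⟨l, hl, hla, hlS⟩ := exists_paths_of_side hf hV hn hXY hno hXYc hW hXn hXP hP6 hx' hx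
    hxx.symm (a := j / 2) (by omega) (by omega)
  obtain ⟨l', hl', hla', hlS'⟩ := exists_paths_of_side hf hV hn hXY.symm hno' (by omega) hW hYn hYQ
    hQ6 hy hy' hyy (a := j - j / 2) (by omega) (by omega)
  have := (hl.append hl' hxy fun v hv hv' =>
    Finset.disjoint_left.1 hPQ (hlS v hv) (hlS' v hv')).hasCycleLength hxy'.symm
      (by rw [List.length_append]; omega)
  convert this using 1
  rw [List.length_append]; omega

end Separated

section Initial

theorem card_le_of_forall_sub_lt {A : Finset ℕ} {n p : ℕ} (hp : ∀ i ∈ A, i % 2 = p)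
    (h : ∀ i ∈ A, ∀ j ∈ A, i < j → 5 * (j - i + 2) < n) : A.card ≤ n / 10 + 1 := by
  rcases A.eq_empty_or_nonempty with rfl | hA
  · simp
  have hm := A.min'_mem hA
  set m := A.min' hA
  have hle : ∀ i ∈ A, m ≤ i := fun i hi => A.min'_le i hi
  rw [← Finset.card_range (n / 10 + 1)]
  refine Finset.card_le_card_of_injOn (fun i => (i - m) / 2) ?_ ?_
  · intro i hi
    have h1 := hle i hi
    rcases h1.eq_or_lt with h2 | h2
    · simp [← h2]
    · have := h m hm i hi h2
      simp only [Finset.coe_range, Set.mem_Iio]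
      omega
  · intro i hi j hj hij
    have h1 := hle i hi
    have h2 := hle j hj
    have h3 := hp i hi
    have h4 := hp j hj
    have h5 := hp m hm
    simp only at hij
    omega

theorem exists_sub_of_card {I : Finset ℕ} {n : ℕ} (hn : 4511 ≤ n) (hI : ∀ i ∈ I, i < 2 * n)
    (hIc : n ≤ 2 * I.card + 3) :
    ∃ i ∈ I, ∃ j ∈ I, i < j ∧ i % 2 = j % 2 ∧ n ≤ 5 * (j - i + 2) ∧ j - i + 2 < n := by
  by_contra! hcon
  have hA : ∀ p a, (I.filter fun i => i % 2 = p ∧ a ≤ i ∧ i < a + (n - 3)).card ≤ n / 10 + 1 := by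
    intro p a
    refine card_le_of_forall_sub_lt (p := p) (fun i hi => (Finset.mem_filter.1 hi).2.1) ?_
    intro i hi j hj hij
    rw [Finset.mem_filter] at hi hj
    by_contra! h5
    have := hcon i hi.1 j hj.1 hij (hi.2.1.trans hj.2.1.symm) h5
    omega
  have hsub : I ⊆ ((I.filter fun i => i % 2 = 0 ∧ 0 ≤ i ∧ i < 0 + (n - 3)) ∪
      (I.filter fun i => i % 2 = 1 ∧ 0 ≤ i ∧ i < 0 + (n - 3))) ∪
      (((I.filter fun i => i % 2 = 0 ∧ n - 3 ≤ i ∧ i < (n - 3) + (n - 3)) ∪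
      (I.filter fun i => i % 2 = 1 ∧ n - 3 ≤ i ∧ i < (n - 3) + (n - 3))) ∪
      Finset.Ico (2 * n - 6) (2 * n)) := by
    intro i hi
    have := hI i hi
    simp only [Finset.mem_union, Finset.mem_filter, Finset.mem_Ico, hi, true_and]
    omega
  have h1 := Finset.card_le_card hsub
  have h2 := hA 0 0
  have h3 := hA 1 0
  have h4 := hA 0 (n - 3)
  have h5 := hA 1 (n - 3)
  have h6 := Nat.card_Ico (2 * n - 6) (2 * n)
  have := h1.trans ((Finset.card_union_le _ _).trans (add_le_add (Finset.card_union_le _ _)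
    ((Finset.card_union_le _ _).trans (add_le_add (Finset.card_union_le _ _) le_rfl))))
  omega

variable {V : Type*} {G : SimpleGraph V} {n : ℕ}

theorem isPathList_drop_take {l : List V} (hl : l.Nodup) (hc : l.IsChain G.Adj) {i j : ℕ}
    (hij : i ≤ j) (hj : j < l.length) :
    IsPathList G l[i] l[j] ((l.drop i).take (j + 1 - i)) := by
  refine ⟨(hl.sublist (List.drop_sublist _ _)).sublist (List.take_sublist _ _),
    (hc.drop i).take _, ?_, ?_⟩
  · rw [List.head?_take, if_neg (by omega), List.head?_drop, List.getElem?_eq_getElem]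
  · rw [List.getLast?_eq_getElem?]
    simp only [List.length_take, List.length_drop]
    rw [List.getElem?_take_of_lt (by omega), List.getElem?_drop,
      show i + (min (j + 1 - i) (l.length - i) - 1) = j by omega, List.getElem?_eq_getElem]

variable [Fintype V]

theorem exists_longest (p : List V → Prop) (hp : ∀ l, p l → l.Nodup) {l₀ : List V} (h₀ : p l₀) :
    ∃ l, p l ∧ ∀ l', p l' → l'.length ≤ l.length := by
  classical
  have hb : ∀ l, p l → l.length ≤ Fintype.card V := fun l hl => (hp l hl).length_le_card
  obtain ⟨l, hl, hlen⟩ := Nat.findGreatest_spec (P := fun k => ∃ l, p l ∧ l.length = k)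
    (hb l₀ h₀) ⟨l₀, h₀, rfl⟩
  refine ⟨l, hl, fun l' hl' => ?_⟩
  rw [hlen]
  exact Nat.le_findGreatest (hb l' hl') ⟨l', hl', rfl⟩

theorem exists_initial_cycle (hf : FewCommonNonneighbors G n) (hV : Fintype.card V = 2 * n)
    (hn : 4511 ≤ n) : ∃ ℓ, Even ℓ ∧ n ≤ 5 * ℓ ∧ ℓ < n ∧ HasCycleLength G ℓ := by
  classical
  obtain ⟨S, -, hSc, hS⟩ := exists_subset_forall_not (S := (Finset.univ : Finset V))
    (P := fun v => 2 * G.degree v + 1 < n) (by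
      intro u _ v _ huv hu hv
      have h1 := hf.le_card_union hV huv
      have h2 := Finset.card_union_le (G.neighborFinset u) (G.neighborFinset v)
      rw [card_neighborFinset_eq_degree, card_neighborFinset_eq_degree] at h2
      omega)
  rw [Finset.card_univ, hV] at hSc
  obtain ⟨v₀, hv₀⟩ : S.Nonempty := Finset.card_pos.1 (by omega)
  obtain ⟨l, ⟨hne, hnd, hch, hlS⟩, hmax⟩ := exists_longest
    (fun l : List V => l ≠ [] ∧ l.Nodup ∧ l.IsChain G.Adj ∧ ∀ v ∈ l, v ∈ S) (fun l hl => hl.2.1)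
    (l₀ := [v₀]) ⟨by simp, by simp, by simp, by simpa using hv₀⟩
  obtain ⟨v, t, rfl⟩ := List.exists_cons_of_ne_nil hne
  have hnb : ∀ w ∈ G.neighborFinset v ∩ S, w ∈ t := by
    intro w hw
    rw [Finset.mem_inter, mem_neighborFinset] at hw
    by_contra hwt
    have := hmax (w :: v :: t) ⟨by simp, List.nodup_cons.2 ⟨by
        rw [List.mem_cons, not_or]; exact ⟨hw.1.ne', hwt⟩, hnd⟩,
      List.isChain_cons_cons.2 ⟨hw.1.symm, hch⟩, by
        intro x hx
        rcases List.mem_cons.1 hx with rfl | hx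
        exacts [hw.2, hlS x hx]⟩
    simp at this
  have ht := List.nodup_cons.1 hnd
  have hcht : t.IsChain G.Adj := hch.of_cons
  have hlen : t.length ≤ 2 * n := hV ▸ ht.2.length_le_card
  have hI : ((G.neighborFinset v ∩ S).image t.idxOf).card = (G.neighborFinset v ∩ S).card :=
    Finset.card_image_of_injOn fun x hx y _ hxy => (List.idxOf_inj (hnb x hx)).1 hxy
  have hdeg : n ≤ 2 * (G.neighborFinset v ∩ S).card + 3 := by
    have h1 := hS v (hlS v (by simp))
    have h2 := Finset.card_inter_add_card_sdiff (G.neighborFinset v) S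
    have h3 : (G.neighborFinset v \ S).card ≤ Sᶜ.card :=
      Finset.card_le_card fun x hx => Finset.mem_compl.2 (Finset.mem_sdiff.1 hx).2
    rw [Finset.card_compl, hV] at h3
    rw [card_neighborFinset_eq_degree] at h2
    omega
  obtain ⟨i, hi, j, hj, hij, hpar, h5, hlt⟩ := exists_sub_of_card (n := n)
    (I := (G.neighborFinset v ∩ S).image t.idxOf) hn (by
      intro i hi
      obtain ⟨w, hw, rfl⟩ := Finset.mem_image.1 hi
      exact (List.idxOf_lt_length_of_mem (hnb w hw)).trans_le hlen) (by omega)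
  have hadj : ∀ i ∈ (G.neighborFinset v ∩ S).image t.idxOf, ∃ h : i < t.length, G.Adj v t[i] := by
    intro i hi
    obtain ⟨w, hw, rfl⟩ := Finset.mem_image.1 hi
    refine ⟨List.idxOf_lt_length_of_mem (hnb w hw), ?_⟩
    rw [List.getElem_idxOf]
    exact (mem_neighborFinset ..).1 (Finset.mem_inter.1 hw).1
  obtain ⟨hil, hvi⟩ := hadj i hi
  obtain ⟨hjl, hvj⟩ := hadj j hj
  have hp := (isPathList_drop_take ht.2 hcht hij.le hjl).cons hvi fun h =>
    ht.1 (List.mem_of_mem_drop (List.mem_of_mem_take h))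
  have hplen : (v :: (t.drop i).take (j + 1 - i)).length = j - i + 2 := by
    simp; omega
  have := hp.hasCycleLength hvj.symm (by omega)
  rw [hplen] at this
  exact ⟨j - i + 2, Nat.even_iff.2 (by omega), h5, hlt, this⟩

end Initial

section Ramsey

theorem FewCommonNonneighbors.hasCycleLength {V : Type*} [Fintype V] {G : SimpleGraph V} {n m : ℕ}
    (hf : FewCommonNonneighbors G n) (hV : Fintype.card V = 2 * n) (hn : 4511 ≤ n) (hm : Even m)
    (hm1 : n + 1 ≤ m) (hm2 : m ≤ 2 * n - 4008) : HasCycleLength G m := by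
  classical
  by_contra hno
  obtain ⟨ℓ₀, he₀, h5₀, hlt₀, hc₀⟩ := exists_initial_cycle hf hV hn
  set ℓ := Nat.findGreatest (fun k => Even k ∧ HasCycleLength G k) (m - 1) with hℓ
  obtain ⟨heven, hcyc⟩ : Even ℓ ∧ HasCycleLength G ℓ :=
    Nat.findGreatest_spec (P := fun k => Even k ∧ HasCycleLength G k) (m := ℓ₀) (by omega)
      ⟨he₀, hc₀⟩
  have hmax : ∀ k, Even k → k < m → HasCycleLength G k → k ≤ ℓ := fun k hk hkm hkc =>
    Nat.le_findGreatest (by omega) ⟨hk, hkc⟩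
  have hℓm : ℓ ≤ m - 1 := Nat.findGreatest_le _
  have h₀ := hmax ℓ₀ he₀ (by omega) hc₀
  have heven' := Nat.even_iff.1 heven
  have hm' := Nat.even_iff.1 hm
  have hstuck : ¬ HasCycleLength G (ℓ + 2) := by
    intro h
    rcases (show ℓ + 2 ≤ m by omega).eq_or_lt with h' | h'
    · exact hno (h' ▸ h)
    · have := hmax (ℓ + 2) (heven.add even_two) h' h
      omega
  obtain ⟨h3, c, hinj, hadj⟩ := hcyc.exists_map
  have : NeZero ℓ := ⟨by omega⟩
  have hS : IsStuckCycle G c n := ⟨hinj, hadj, hstuck, hf, hV, hn, by omega, by omega⟩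
  obtain ⟨X, Y, hXY, hXYn, hX, hY, hXYc, hℓX⟩ := hS.exists_separation
  have hXn := card_lt_of_separated hf hXY hXYn hY
  have hall : ∀ j, n + 1 ≤ j → j ≤ n + 40 → HasCycleLength G j := fun j hj hj' =>
    hasCycleLength_of_separated hf hV hn hXY hXYn hX hY hXYc hj hj'
  rcases Nat.lt_or_ge (ℓ + 2) (n + 1) with hlt | hge
  · obtain ⟨j, hj, hj1, hj2⟩ : ∃ j, Even j ∧ n + 1 ≤ j ∧ j ≤ n + 2 := by
      rcases Nat.even_or_odd (n + 1) with h | h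
      · exact ⟨n + 1, h, le_rfl, by omega⟩
      · exact ⟨n + 2, h.add_one, by omega, le_rfl⟩
    have hj' := Nat.even_iff.1 hj
    have hc := hall j hj1 (by omega)
    rcases (show j ≤ m by omega).eq_or_lt with h | h
    · exact hno (h ▸ hc)
    · have := hmax j hj h hc
      omega
  · exact hstuck (hall (ℓ + 2) hge (by omega))

theorem Contains.of_not_fewCommonNonneighbors {V : Type*} {Γ : SimpleGraph V} {n : ℕ}
    (h : ¬ FewCommonNonneighbors Γᶜ n) : Contains Γ (completeBipartiteGraph (Fin 2) (Fin n)) := by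
  rw [FewCommonNonneighbors] at h
  push Not at h
  obtain ⟨u, v, huv, S, hS, hSn⟩ := h
  obtain ⟨e⟩ : Nonempty (Fin n ↪ S) :=
    Function.Embedding.nonempty_of_card_le (by simpa using hSn)
  have hS' : ∀ w ∈ S, w ≠ u ∧ w ≠ v ∧ Γ.Adj u w ∧ Γ.Adj v w := by
    intro w hw
    obtain ⟨h1, h2, h3, h4⟩ := hS w hw
    rw [compl_adj, not_and, not_not] at h3 h4
    exact ⟨h1, h2, h3 h1.symm, h4 h2.symm⟩
  have hpq : ∀ (p : Fin 2) (q : Fin n), Γ.Adj (![u, v] p) (e q) := by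
    intro p q
    have := hS' _ (e q).2
    fin_cases p
    exacts [this.2.2.1, this.2.2.2]
  refine ⟨⟨Sum.elim ![u, v] fun q => (e q : V), ?_⟩, ?_⟩
  · rintro (p | p) (q | q) hpq'
    · simp at hpq'
    · exact hpq p q
    · exact (hpq q p).symm
    · simp at hpq'
  · refine Function.Injective.sumElim ?_ (Subtype.val_injective.comp e.injective)
      fun p q => (hpq p q).ne
    intro p q h
    fin_cases p <;> fin_cases q <;> first | rfl | exact absurd h huv | exact absurd h huv.symm

theorem Contains.bipartite_mono {V : Type*} {Γ : SimpleGraph V} {a b n : ℕ} (hab : a ≤ b)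
    (h : Contains Γ (completeBipartiteGraph (Fin b) (Fin n))) :
    Contains Γ (completeBipartiteGraph (Fin a) (Fin n)) := by
  obtain ⟨f, hf⟩ := h
  refine ⟨⟨fun x => f (Sum.map (Fin.castLE hab) id x), fun {x y} hxy => f.map_rel ?_⟩,
    hf.comp (Function.Injective.sumMap (Fin.castLE_injective hab) Function.injective_id)⟩
  rcases x with x | x <;> rcases y with y | y <;> simp_all

/-- The complete bipartite graph between `{1, …, n - 1}` and `{n, …, N - 1}`, with `0` isolated. -/
def isolatedBipartite (n N : ℕ) : SimpleGraph (Fin N) where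
  Adj x y := (1 ≤ x.val ∧ x.val < n ∧ n ≤ y.val) ∨ (1 ≤ y.val ∧ y.val < n ∧ n ≤ x.val)
  symm := ⟨fun _ _ h => h.symm⟩
  loopless := ⟨fun _ h => by omega⟩

theorem not_injective_of_mem_Ico {n a b : ℕ} {α : Type*} [Fintype α] (hα : n ≤ Fintype.card α)
    (hab : b < n + a) (hn : 0 < n) (f : α → ℕ) (h : ∀ i, a ≤ f i ∧ f i < b) :
    ¬ Function.Injective f := by
  intro hf
  have := Finset.card_le_card_of_injOn (s := Finset.univ) (t := Finset.Ico a b) f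
    (fun i _ => by simpa using h i) hf.injOn
  rw [Finset.card_univ, Nat.card_Ico] at this
  omega

theorem not_contains_isolatedBipartite {a n N : ℕ} (ha : 0 < a) (hn : 0 < n) (hN : N < 2 * n) :
    ¬ Contains (isolatedBipartite n N) (completeBipartiteGraph (Fin a) (Fin n)) := by
  rintro ⟨f, hf⟩
  have hadj : ∀ q : Fin n, (isolatedBipartite n N).Adj (f (.inl ⟨0, ha⟩)) (f (.inr q)) :=
    fun q => f.map_rel (by simp)
  have hinj : Function.Injective fun q : Fin n => (f (.inr q)).val :=
    Fin.val_injective.comp (hf.comp Sum.inr_injective)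
  by_cases hx : (f (.inl ⟨0, ha⟩)).val < n
  · refine not_injective_of_mem_Ico (n := n) (a := n) (b := N) (by simp) (by omega) hn _
      (fun q => ?_) hinj
    have := hadj q
    simp only [isolatedBipartite] at this
    omega
  · refine not_injective_of_mem_Ico (n := n) (a := 1) (b := n) (by simp) (by omega) hn _
      (fun q => ?_) hinj
    have := hadj q
    simp only [isolatedBipartite] at this
    omega

theorem not_hasCycleLength_isolatedBipartite {n m N : ℕ} (hn : 0 < n) (hN : N < 2 * n)
    (hm : n + 1 ≤ m) : ¬ HasCycleLength (isolatedBipartite n N)ᶜ m := by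
  intro h
  obtain ⟨h3, c, hinj, hadj⟩ := h.exists_map
  have : NeZero m := ⟨by omega⟩
  obtain ⟨i, hi⟩ : ∃ i, ∀ t : ℕ, t < m - 1 → (c (i + 1 + t)).val ≠ 0 := by
    by_cases h0 : ∃ i, (c i).val = 0
    · obtain ⟨i, hi⟩ := h0
      refine ⟨i, fun t ht h => ?_⟩
      have h1 : i + 1 + t = i := hinj (Fin.val_injective (h.trans hi.symm))
      have h2 : ((t + 1 : ℕ) : ZMod m) = ((0 : ℕ) : ZMod m) := by
        push_cast; linear_combination h1
      have := natCast_zmod_inj (by omega) (by omega) h2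
      omega
    · push Not at h0
      exact ⟨0, fun t _ => h0 _⟩
  have hstep : ∀ t : ℕ, t < m - 1 → ((c (i + 1 + t)).val < n ↔ (c (i + 1)).val < n) := by
    intro t
    induction t with
    | zero => simp
    | succ t ih =>
      intro ht
      rw [← ih (by omega)]
      have h1 := hadj (i + 1 + t)
      have h2 := hi t (by omega)
      have h3 := hi (t + 1) ht
      rw [Nat.cast_succ, ← add_assoc] at h3 ⊢
      rw [compl_adj] at h1
      simp only [isolatedBipartite] at h1
      omega
  have hinj' : Function.Injective fun t : Fin (m - 1) => (c (i + 1 + (t.val : ZMod m))).val := by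
    intro s t hst
    have h1 := add_left_cancel (hinj (Fin.val_injective hst))
    exact Fin.val_injective (natCast_zmod_inj (by omega) (by omega) h1)
  by_cases hx : (c (i + 1)).val < n
  · refine not_injective_of_mem_Ico (n := n) (a := 1) (b := n) (by simp; omega) (by omega) hn _
      (fun t => ?_) hinj'
    have h1 := hi t t.2
    have h2 := hstep t t.2
    omega
  · refine not_injective_of_mem_Ico (n := n) (a := n) (b := N) (by simp; omega) (by omega) hn _
      (fun t => ?_) hinj'
    have h2 := hstep t t.2
    omega

theorem RamseyProp.two_mul_le {a n m N : ℕ} (ha : 0 < a) (hn : 0 < n) (hm : n + 1 ≤ m)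
    (h : RamseyProp a n m N) : 2 * n ≤ N := by
  by_contra! hN
  rcases h (isolatedBipartite n N) with h | h
  · exact not_contains_isolatedBipartite ha hn hN h
  · exact not_hasCycleLength_isolatedBipartite hn hN hm h

theorem ramseyProp_two {n m : ℕ} (hn : 4511 ≤ n) (hm : Even m) (hm1 : n + 1 ≤ m)
    (hm2 : m ≤ 2 * n - 4008) : RamseyProp 2 n m (2 * n) := by
  intro Γ
  by_cases hf : FewCommonNonneighbors Γᶜ n
  · exact .inr (hf.hasCycleLength (by simp) hn hm hm1 hm2)
  · exact .inl (.of_not_fewCommonNonneighbors hf)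

end Ramsey

theorem stmt_18 (n m : ℕ) (hn : 4511 ≤ n) (hm : Even m)
    (hm1 : n + 1 ≤ m) (hm2 : m ≤ 2 * n - 4008) :
    IsLeast {N | RamseyProp 1 n m N} (2 * n) ∧
      IsLeast {N | RamseyProp 2 n m N} (2 * n) := by
  have h := ramseyProp_two hn hm hm1 hm2
  exact ⟨⟨fun Γ => (h Γ).imp_left (Contains.bipartite_mono one_le_two),
      fun _ hN => hN.two_mul_le one_pos (by omega) hm1⟩,
    ⟨h, fun _ hN => hN.two_mul_le two_pos (by omega) hm1⟩⟩
end
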